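/- arXiv:1611.02732 — 5 statements merged into one kernel-verified Lean document; each statement's English description precedes it below -/
import Mathlib

section
/- Let Ω ⊆ ℝ² be a bounded open set, and let ζ : ℝ² → ℝ be continuously differentiable on the closure of Ω and three times continuously differentiable on Ω, satisfying pointwise on Ω the equation (1 − ‖∇ζ‖²)·Δζ − ⟨∇(‖∇ζ‖²), ∇ζ⟩ = 0. If ‖∇ζ(x)‖ < 1/√3 for every x in the closure of Ω, then sup_{x ∈ closure(Ω)} ‖∇ζ(x)‖ = sup_{x ∈ frontier(Ω)} ‖∇ζ(x)‖, i.e. the maximum of ‖∇ζ‖ over the closure of Ω is attained on the boundary ∂Ω. -/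
open scoped BigOperators

/-- The `i`-th partial derivative of `f : ℝ² → ℝ` at `x`, taken within the set `s`. -/
noncomputable def pdW (s : Set (EuclideanSpace ℝ (Fin 2))) (i : Fin 2)
    (f : EuclideanSpace ℝ (Fin 2) → ℝ) (x : EuclideanSpace ℝ (Fin 2)) : ℝ :=
  fderivWithin ℝ f s x (EuclideanSpace.single i 1)

/-- `‖∇ζ‖²` computed with derivatives within `s`. -/
noncomputable def gradSqW (s : Set (EuclideanSpace ℝ (Fin 2)))
    (ζ : EuclideanSpace ℝ (Fin 2) → ℝ) (x : EuclideanSpace ℝ (Fin 2)) : ℝ :=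
  ∑ i, (pdW s i ζ x) ^ 2

open Filter Topology

/-- The `i`-th partial derivative of `f : ℝ² → ℝ`. -/
noncomputable def partialDeriv (i : Fin 2) (f : EuclideanSpace ℝ (Fin 2) → ℝ)
    (x : EuclideanSpace ℝ (Fin 2)) : ℝ :=
  fderiv ℝ f x (EuclideanSpace.single i 1)

section PartialDeriv

variable {f g : EuclideanSpace ℝ (Fin 2) → ℝ} {x : EuclideanSpace ℝ (Fin 2)}
  {Ω : Set (EuclideanSpace ℝ (Fin 2))}

theorem Filter.EventuallyEq.partialDeriv_eq (h : f =ᶠ[𝓝 x] g) (i : Fin 2) :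
    partialDeriv i f x = partialDeriv i g x := by
  simp only [partialDeriv, h.fderiv_eq]

theorem partialDeriv_add (hf : DifferentiableAt ℝ f x) (hg : DifferentiableAt ℝ g x)
    (i : Fin 2) :
    partialDeriv i (fun y => f y + g y) x = partialDeriv i f x + partialDeriv i g x := by
  simp [partialDeriv, fderiv_fun_add hf hg]

theorem partialDeriv_sub (hf : DifferentiableAt ℝ f x) (hg : DifferentiableAt ℝ g x)
    (i : Fin 2) :
    partialDeriv i (fun y => f y - g y) x = partialDeriv i f x - partialDeriv i g x := by
  simp [partialDeriv, fderiv_fun_sub hf hg]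

theorem partialDeriv_mul (hf : DifferentiableAt ℝ f x) (hg : DifferentiableAt ℝ g x)
    (i : Fin 2) :
    partialDeriv i (fun y => f y * g y) x =
      partialDeriv i f x * g x + f x * partialDeriv i g x := by
  simp [partialDeriv, fderiv_fun_mul hf hg]
  ring

theorem partialDeriv_const (c : ℝ) (i : Fin 2) : partialDeriv i (fun _ => c) x = 0 := by
  simp [partialDeriv]

theorem partialDeriv_coord (i j : Fin 2) :
    partialDeriv i (fun y => y j) x = if j = i then 1 else 0 := by
  have h : HasFDerivAt (fun y : EuclideanSpace ℝ (Fin 2) => y j)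
      (EuclideanSpace.proj j : EuclideanSpace ℝ (Fin 2) →L[ℝ] ℝ) x :=
    (EuclideanSpace.proj j : EuclideanSpace ℝ (Fin 2) →L[ℝ] ℝ).hasFDerivAt
  simp [partialDeriv, h.fderiv]

theorem ContDiffOn.partialDeriv {m n : WithTop ℕ∞} (hf : ContDiffOn ℝ n f Ω) (hΩ : IsOpen Ω)
    (hmn : m + 1 ≤ n) (i : Fin 2) : ContDiffOn ℝ m (partialDeriv i f) Ω :=
  (hf.fderiv_of_isOpen hΩ hmn).clm_apply contDiffOn_const

theorem ContDiffAt.differentiableAt_fderiv (hf : ContDiffAt ℝ 2 f x) :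
    DifferentiableAt ℝ (fderiv ℝ f) x :=
  (hf.fderiv_right (m := 1) (by norm_num)).differentiableAt (by norm_num)

theorem ContDiffAt.partialDeriv_partialDeriv (hf : ContDiffAt ℝ 2 f x) (i j : Fin 2) :
    partialDeriv i (_root_.partialDeriv j f) x =
      fderiv ℝ (fderiv ℝ f) x (EuclideanSpace.single i 1) (EuclideanSpace.single j 1) := by
  unfold _root_.partialDeriv
  rw [fderiv_clm_apply hf.differentiableAt_fderiv (differentiableAt_const _)]
  simp

theorem ContDiffAt.partialDeriv_comm (hf : ContDiffAt ℝ 2 f x) (i j : Fin 2) :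
    partialDeriv i (_root_.partialDeriv j f) x =
      _root_.partialDeriv j (_root_.partialDeriv i f) x := by
  rw [hf.partialDeriv_partialDeriv, hf.partialDeriv_partialDeriv]
  exact hf.isSymmSndFDerivAt (by simp) _ _

theorem IsLocalMax.partialDeriv_eq_zero (h : IsLocalMax f x) (i : Fin 2) :
    partialDeriv i f x = 0 := by
  simp [partialDeriv, h.fderiv_eq_zero]

end PartialDeriv

/-- Necessary second order condition at a local maximum on the line. -/
theorem IsLocalMax.deriv_deriv_nonpos {f : ℝ → ℝ} {x : ℝ} (h : IsLocalMax f x)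
    (hc : ContinuousAt f x) : deriv (deriv f) x ≤ 0 := by
  by_contra! hpos
  have hmin := isLocalMin_of_deriv_deriv_pos hpos h.deriv_eq_zero hc
  have heq : f =ᶠ[𝓝 x] fun _ => f x := by
    filter_upwards [h, hmin] with y h₁ h₂ using le_antisymm h₁ h₂
  have h0 := heq.deriv.deriv_eq
  simp at h0
  exact hpos.ne' h0

theorem IsLocalMax.fderiv_fderiv_nonpos {E : Type*} [NormedAddCommGroup E] [NormedSpace ℝ E]
    {f : E → ℝ} {x : E} (h : IsLocalMax f x) (hf : ContDiffAt ℝ 2 f x) (w : E) :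
    fderiv ℝ (fderiv ℝ f) x w w ≤ 0 := by
  have hline : ∀ t : ℝ, HasDerivAt (fun t : ℝ => x + t • w) w t := fun t => by
    simpa using ((hasDerivAt_id t).smul_const w).const_add x
  have hcont : ContinuousAt (fun t : ℝ => x + t • w) 0 := (hline 0).continuousAt
  have hx0 : x + (0 : ℝ) • w = x := by simp
  have htend : Tendsto (fun t : ℝ => x + t • w) (𝓝 0) (𝓝 x) := by
    simpa [ContinuousAt] using hcont
  have hdiff : ∀ᶠ y in 𝓝 x, DifferentiableAt ℝ f y := by
    filter_upwards [hf.eventually (by simp)] with y hy using hy.differentiableAt (by norm_num)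
  have hderiv : deriv (fun t : ℝ => f (x + t • w)) =ᶠ[𝓝 0]
      fun t => fderiv ℝ f (x + t • w) w := by
    filter_upwards [htend.eventually hdiff] with t ht
    exact (ht.hasFDerivAt.comp_hasDerivAt t (hline t)).deriv
  have hd : DifferentiableAt ℝ (fderiv ℝ f) x :=
    (hf.fderiv_right (m := 1) (by norm_num)).differentiableAt (by norm_num)
  have hmax : IsLocalMax (fun t : ℝ => f (x + t • w)) 0 := by
    have := htend.eventually h
    simpa [IsLocalMax, IsMaxFilter] using this
  have hc : ContinuousAt (fun t : ℝ => f (x + t • w)) 0 :=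
    ContinuousAt.comp (g := f) (by rw [hx0]; exact hf.continuousAt) hcont
  have h2 : HasDerivAt (fun t : ℝ => fderiv ℝ f (x + t • w)) (fderiv ℝ (fderiv ℝ f) x w) 0 := by
    have hd' : HasFDerivAt (fderiv ℝ f) (fderiv ℝ (fderiv ℝ f) x) (x + (0 : ℝ) • w) := by
      rw [hx0]; exact hd.hasFDerivAt
    exact hd'.comp_hasDerivAt 0 (hline 0)
  have h3 := h2.clm_apply (hasDerivAt_const (0 : ℝ) w)
  have := hmax.deriv_deriv_nonpos hc
  rw [hderiv.deriv_eq, h3.deriv] at this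
  simpa using this

theorem IsLocalMax.partialDeriv_hessian_nonpos {f : EuclideanSpace ℝ (Fin 2) → ℝ}
    {x : EuclideanSpace ℝ (Fin 2)} (h : IsLocalMax f x) (hf : ContDiffAt ℝ 2 f x) (a b : ℝ) :
    a ^ 2 * partialDeriv 0 (partialDeriv 0 f) x + 2 * (a * b) * partialDeriv 0 (partialDeriv 1 f) x
      + b ^ 2 * partialDeriv 1 (partialDeriv 1 f) x ≤ 0 := by
  have hcomm := hf.partialDeriv_comm 0 1
  have := h.fderiv_fderiv_nonpos hf
    (a • EuclideanSpace.single 0 1 + b • EuclideanSpace.single 1 1)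
  simp only [map_add, map_smul, add_apply, smul_apply,
    smul_eq_mul, ← hf.partialDeriv_partialDeriv] at this
  rw [← hcomm] at this
  linarith

/-- The pointwise inequality behind the Bernstein argument: the Hessian `H` of `ζ`, with entries
`u₁, u₂, v₂`, the differentiated equation, and the first and second order conditions for
`|∇ζ|² + ε|x|²` at a maximum force `(1 - 3|∇ζ|²)² ≤ ε|x|²`. -/
theorem bernstein_pointwise {u v u₁ u₂ v₂ u₁₁ u₁₂ u₂₂ v₂₂ ε x y : ℝ} (hε : 0 < ε)
    (hg : u ^ 2 + v ^ 2 < 1 / 3)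
    (hP₁ : -(2 * u * u₁ + 2 * v * u₂) * (u₁ + v₂) + (1 - (u ^ 2 + v ^ 2)) * (u₁₁ + u₂₂)
      - (4 * u * u₁ * u₁ + 2 * u ^ 2 * u₁₁ + 4 * (u₁ * v + u * u₂) * u₂ + 4 * u * v * u₁₂
        + 4 * v * u₂ * v₂ + 2 * v ^ 2 * u₂₂) = 0)
    (hP₂ : -(2 * u * u₂ + 2 * v * v₂) * (u₁ + v₂) + (1 - (u ^ 2 + v ^ 2)) * (u₁₂ + v₂₂)
      - (4 * u * u₂ * u₁ + 2 * u ^ 2 * u₁₂ + 4 * (u₂ * v + u * v₂) * u₂ + 4 * u * v * u₂₂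
        + 4 * v * v₂ * v₂ + 2 * v ^ 2 * v₂₂) = 0)
    (hg₁ : 2 * u * u₁ + 2 * v * u₂ + 2 * ε * x = 0)
    (hg₂ : 2 * u * u₂ + 2 * v * v₂ + 2 * ε * y = 0)
    (hH : ∀ a b : ℝ,
      a ^ 2 * (2 * u₁ ^ 2 + 2 * u * u₁₁ + 2 * u₂ ^ 2 + 2 * v * u₁₂ + 2 * ε)
      + 2 * (a * b) * (2 * u₁ * u₂ + 2 * u * u₁₂ + 2 * u₂ * v₂ + 2 * v * u₂₂)
      + b ^ 2 * (2 * u₂ ^ 2 + 2 * u * u₂₂ + 2 * v₂ ^ 2 + 2 * v * v₂₂ + 2 * ε) ≤ 0) :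
    (1 - 3 * (u ^ 2 + v ^ 2)) ^ 2 ≤ ε * (x ^ 2 + y ^ 2) := by
  set l := 1 - 3 * (u ^ 2 + v ^ 2) with hl
  have hl0 : 0 < l := by linarith
  have h₁ := mul_le_mul_of_nonneg_left (hH 1 0) hl0.le
  have h₂ := mul_le_mul_of_nonneg_left (hH 0 1) hl0.le
  have h₃ := hH (-v) u
  set q := u * (-2 * ε * x) + v * (-2 * ε * y) with hq
  have ex : -2 * ε * x = 2 * u * u₁ + 2 * v * u₂ := by linarith
  have ey : -2 * ε * y = 2 * u * u₂ + 2 * v * v₂ := by linarith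
  have hmain : 2 * l * (u₁ ^ 2 + 2 * u₂ ^ 2 + v₂ ^ 2) + 2 * q * (u₁ + v₂)
      + 4 * ε * (l + (u ^ 2 + v ^ 2)) ≤ 0 := by
    have hid : 2 * l * (u₁ ^ 2 + 2 * u₂ ^ 2 + v₂ ^ 2) + 2 * q * (u₁ + v₂)
      + 4 * ε * (l + (u ^ 2 + v ^ 2))
      + 4 * ((-v * u₁ + u * u₂) ^ 2 + (-v * u₂ + u * v₂) ^ 2)
      + 2 * ((2 * u * u₁ + 2 * v * u₂) ^ 2 + (2 * u * u₂ + 2 * v * v₂) ^ 2)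
      = l * (1 ^ 2 * (2 * u₁ ^ 2 + 2 * u * u₁₁ + 2 * u₂ ^ 2 + 2 * v * u₁₂ + 2 * ε)
      + 2 * (1 * 0) * (2 * u₁ * u₂ + 2 * u * u₁₂ + 2 * u₂ * v₂ + 2 * v * u₂₂)
      + 0 ^ 2 * (2 * u₂ ^ 2 + 2 * u * u₂₂ + 2 * v₂ ^ 2 + 2 * v * v₂₂ + 2 * ε))
      + l * (0 ^ 2 * (2 * u₁ ^ 2 + 2 * u * u₁₁ + 2 * u₂ ^ 2 + 2 * v * u₁₂ + 2 * ε)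
      + 2 * (0 * 1) * (2 * u₁ * u₂ + 2 * u * u₁₂ + 2 * u₂ * v₂ + 2 * v * u₂₂)
      + 1 ^ 2 * (2 * u₂ ^ 2 + 2 * u * u₂₂ + 2 * v₂ ^ 2 + 2 * v * v₂₂ + 2 * ε))
      + 2 * ((-v) ^ 2 * (2 * u₁ ^ 2 + 2 * u * u₁₁ + 2 * u₂ ^ 2 + 2 * v * u₁₂ + 2 * ε)
      + 2 * (-v * u) * (2 * u₁ * u₂ + 2 * u * u₁₂ + 2 * u₂ * v₂ + 2 * v * u₂₂)
      + u ^ 2 * (2 * u₂ ^ 2 + 2 * u * u₂₂ + 2 * v₂ ^ 2 + 2 * v * v₂₂ + 2 * ε)) := by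
      rw [hq, ex, ey, hl]
      linear_combination (-2 * u) * hP₁ + (-2 * v) * hP₂
    nlinarith [sq_nonneg (-v * u₁ + u * u₂), sq_nonneg (-v * u₂ + u * v₂),
      sq_nonneg (2 * u * u₁ + 2 * v * u₂), sq_nonneg (2 * u * u₂ + 2 * v * v₂)]
  have hq2 : q ^ 2 ≤ 4 * ε ^ 2 * (x ^ 2 + y ^ 2) := by
    have e : q ^ 2 + 4 * ε ^ 2 * (u * y - v * x) ^ 2
        = 4 * ε ^ 2 * ((u ^ 2 + v ^ 2) * (x ^ 2 + y ^ 2)) := by rw [hq]; ring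
    have h1 : (u ^ 2 + v ^ 2) * (x ^ 2 + y ^ 2) ≤ x ^ 2 + y ^ 2 :=
      mul_le_of_le_one_left (by positivity) (by linarith)
    have h2 : 0 ≤ 4 * ε ^ 2 * (u * y - v * x) ^ 2 := by positivity
    have h3 := mul_le_mul_of_nonneg_left h1 (show (0 : ℝ) ≤ 4 * ε ^ 2 by positivity)
    linarith
  have hΔ : l * (u₁ + v₂) ^ 2 + 2 * q * (u₁ + v₂) + 4 * ε * l ≤ 0 := by
    have h1 : 0 ≤ l * ((u₁ - v₂) ^ 2 + 4 * u₂ ^ 2) := by positivity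
    have h2 : 0 ≤ 4 * ε * (u ^ 2 + v ^ 2) := by positivity
    linarith
  have hfin : 4 * ε * l ^ 2 ≤ 4 * ε * (ε * (x ^ 2 + y ^ 2)) := by
    have h1 := mul_le_mul_of_nonneg_left hΔ hl0.le
    have h2 := sq_nonneg (l * (u₁ + v₂) + q)
    linarith
  exact le_of_mul_le_mul_left hfin (by positivity)

theorem bernstein_at_max {Ω : Set (EuclideanSpace ℝ (Fin 2))} (hΩ : IsOpen Ω)
    {ζ : EuclideanSpace ℝ (Fin 2) → ℝ} (hζ : ContDiffOn ℝ 3 ζ Ω)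
    (hpde : ∀ y ∈ Ω,
      (1 - (partialDeriv 0 ζ y ^ 2 + partialDeriv 1 ζ y ^ 2)) *
          (partialDeriv 0 (partialDeriv 0 ζ) y + partialDeriv 1 (partialDeriv 1 ζ) y) -
        (partialDeriv 0 (fun z => partialDeriv 0 ζ z ^ 2 + partialDeriv 1 ζ z ^ 2) y *
            partialDeriv 0 ζ y +
          partialDeriv 1 (fun z => partialDeriv 0 ζ z ^ 2 + partialDeriv 1 ζ z ^ 2) y *
            partialDeriv 1 ζ y) = 0)
    {x : EuclideanSpace ℝ (Fin 2)} (hx : x ∈ Ω) {ε : ℝ} (hε : 0 < ε)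
    (hmax : IsLocalMax (fun y => partialDeriv 0 ζ y ^ 2 + partialDeriv 1 ζ y ^ 2 +
      ε * (y 0 ^ 2 + y 1 ^ 2)) x)
    (hg : partialDeriv 0 ζ x ^ 2 + partialDeriv 1 ζ x ^ 2 < 1 / 3) :
    (1 - 3 * (partialDeriv 0 ζ x ^ 2 + partialDeriv 1 ζ x ^ 2)) ^ 2 ≤
      ε * (x 0 ^ 2 + x 1 ^ 2) := by
  have hcomm : ∀ y ∈ Ω, partialDeriv 0 (partialDeriv 1 ζ) y = partialDeriv 1 (partialDeriv 0 ζ) y :=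
    fun y hy => ((hζ.contDiffAt (hΩ.mem_nhds hy)).of_le (by norm_num)).partialDeriv_comm 0 1
  have hu : ContDiffOn ℝ 2 (partialDeriv 0 ζ) Ω := hζ.partialDeriv hΩ (by norm_num) 0
  have hv : ContDiffOn ℝ 2 (partialDeriv 1 ζ) Ω := hζ.partialDeriv hΩ (by norm_num) 1
  generalize partialDeriv 0 ζ = u at *
  generalize partialDeriv 1 ζ = v at *
  simp only [sq] at hmax hpde
  have hmem : ∀ᶠ y in 𝓝 x, y ∈ Ω := hΩ.mem_nhds hx
  have hu1 : ContDiffOn ℝ 1 (partialDeriv 0 u) Ω := hu.partialDeriv hΩ (by norm_num) 0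
  have hu2 : ContDiffOn ℝ 1 (partialDeriv 1 u) Ω := hu.partialDeriv hΩ (by norm_num) 1
  have hv2 : ContDiffOn ℝ 1 (partialDeriv 1 v) Ω := hv.partialDeriv hΩ (by norm_num) 1
  have du : ∀ y ∈ Ω, DifferentiableAt ℝ u y := fun y hy =>
    (hu.contDiffAt (hΩ.mem_nhds hy)).differentiableAt (by norm_num)
  have dv : ∀ y ∈ Ω, DifferentiableAt ℝ v y := fun y hy =>
    (hv.contDiffAt (hΩ.mem_nhds hy)).differentiableAt (by norm_num)
  have du1 : DifferentiableAt ℝ (partialDeriv 0 u) x :=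
    (hu1.contDiffAt (hΩ.mem_nhds hx)).differentiableAt (by norm_num)
  have du2 : DifferentiableAt ℝ (partialDeriv 1 u) x :=
    (hu2.contDiffAt (hΩ.mem_nhds hx)).differentiableAt (by norm_num)
  have dv2 : DifferentiableAt ℝ (partialDeriv 1 v) x :=
    (hv2.contDiffAt (hΩ.mem_nhds hx)).differentiableAt (by norm_num)
  have dux := du x hx
  have dvx := dv x hx
  have hcommu : partialDeriv 0 (partialDeriv 1 u) x = partialDeriv 1 (partialDeriv 0 u) x :=
    (hu.contDiffAt (hΩ.mem_nhds hx)).partialDeriv_comm 0 1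
  have hcommv : partialDeriv 0 (partialDeriv 1 v) x = partialDeriv 1 (partialDeriv 1 u) x := by
    rw [(hv.contDiffAt (hΩ.mem_nhds hx)).partialDeriv_comm 0 1]
    exact EventuallyEq.partialDeriv_eq (hmem.mono hcomm) 1
  -- the expanded equation
  have hP : (fun y => (1 - (u y * u y + v y * v y)) * (partialDeriv 0 u y + partialDeriv 1 v y) -
      (2 * (u y * u y * partialDeriv 0 u y) + 4 * (u y * v y * partialDeriv 1 u y) +
        2 * (v y * v y * partialDeriv 1 v y))) =ᶠ[𝓝 x] fun _ => 0 := by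
    filter_upwards [hmem] with y hy
    have := hpde y hy
    have duy := du y hy
    have dvy := dv y hy
    simp (disch := fun_prop) only [partialDeriv_add, partialDeriv_mul, hcomm y hy] at this
    linarith
  have hP₁ := hP.partialDeriv_eq 0
  have hP₂ := hP.partialDeriv_eq 1
  simp (disch := fun_prop) only [partialDeriv_add, partialDeriv_sub, partialDeriv_mul,
    partialDeriv_const, hcomm x hx, hcommu, hcommv] at hP₁ hP₂
  -- first derivatives of the auxiliary function
  have hF : ∀ i, partialDeriv i (fun y : EuclideanSpace ℝ (Fin 2) =>
        u y * u y + v y * v y + ε * (y 0 * y 0 + y 1 * y 1)) =ᶠ[𝓝 x]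
      fun y => 2 * (u y * partialDeriv i u y) + 2 * (v y * partialDeriv i v y) +
        2 * ε * y i := by
    intro i
    filter_upwards [hmem] with y hy
    have duy := du y hy
    have dvy := dv y hy
    simp (disch := fun_prop) only [partialDeriv_add, partialDeriv_mul, partialDeriv_const,
      partialDeriv_coord]
    fin_cases i <;> simp <;> ring
  have hF0 : partialDeriv 0 (fun y : EuclideanSpace ℝ (Fin 2) =>
        u y * u y + v y * v y + ε * (y 0 * y 0 + y 1 * y 1)) =ᶠ[𝓝 x]
      fun y => 2 * (u y * partialDeriv 0 u y) + 2 * (v y * partialDeriv 1 u y) +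
        2 * ε * y 0 := by
    filter_upwards [hF 0, hmem] with y hy hyΩ
    rw [hy, hcomm y hyΩ]
  have hF_smooth : ContDiffAt ℝ 2 (fun y : EuclideanSpace ℝ (Fin 2) =>
      u y * u y + v y * v y + ε * (y 0 * y 0 + y 1 * y 1)) x := by
    have h1 := hu.contDiffAt (hΩ.mem_nhds hx)
    have h2 := hv.contDiffAt (hΩ.mem_nhds hx)
    fun_prop
  have hg₁ := hmax.partialDeriv_eq_zero 0
  have hg₂ := hmax.partialDeriv_eq_zero 1
  rw [hF0.eq_of_nhds] at hg₁
  rw [(hF 1).eq_of_nhds] at hg₂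
  have hH := hmax.partialDeriv_hessian_nonpos hF_smooth
  rw [hF0.partialDeriv_eq, (hF 1).partialDeriv_eq, (hF 1).partialDeriv_eq] at hH
  simp (disch := fun_prop) only [partialDeriv_add, partialDeriv_mul,
    partialDeriv_const, partialDeriv_coord, hcomm x hx, hcommu, hcommv] at hH
  simp only [if_true, if_false, one_ne_zero] at hH
  refine bernstein_pointwise (u₁ := partialDeriv 0 u x) (u₂ := partialDeriv 1 u x)
    (v₂ := partialDeriv 1 v x) (u₁₁ := partialDeriv 0 (partialDeriv 0 u) x)
    (u₁₂ := partialDeriv 1 (partialDeriv 0 u) x) (u₂₂ := partialDeriv 1 (partialDeriv 1 u) x)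
    (v₂₂ := partialDeriv 1 (partialDeriv 1 v) x) hε hg ?_ ?_ ?_ ?_ ?_
  · linarith
  · linarith
  · linarith
  · linarith
  · intro a b
    have := hH a b
    linarith

/-- A continuous function on a bounded open set which stays below `c` near the frontier and
reaches `c` somewhere inside attains its maximum inside. -/
theorem exists_isMaxOn_of_lt_near_frontier {E : Type*} [MetricSpace E] [ProperSpace E]
    {Ω : Set E} (hΩ : IsOpen Ω) (hΩb : Bornology.IsBounded Ω) {φ : E → ℝ}
    (hφ : ContinuousOn φ Ω) {x₀ : E} (hx₀ : x₀ ∈ Ω)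
    (hfr : ∀ y ∈ frontier Ω, ∀ᶠ x in 𝓝[Ω] y, φ x < φ x₀) :
    ∃ x ∈ Ω, IsMaxOn φ Ω x := by
  have hclosed : IsClosed {x ∈ Ω | φ x₀ ≤ φ x} := by
    rw [← closure_subset_iff_isClosed]
    intro y hy
    have hyc : y ∈ closure Ω := closure_mono (Set.sep_subset _ _) hy
    by_cases hyΩ : y ∈ Ω
    · refine ⟨hyΩ, ?_⟩
      by_contra! hlt
      have hev : ∀ᶠ x in 𝓝 y, φ x < φ x₀ :=
        (hφ.continuousAt (hΩ.mem_nhds hyΩ)).eventually_lt_const hlt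
      obtain ⟨z, hz, hz'⟩ := mem_closure_iff_nhds.1 hy _ hev
      exact absurd hz'.2 (not_le.2 hz)
    · have hyf : y ∈ frontier Ω := by rw [hΩ.frontier_eq]; exact ⟨hyc, hyΩ⟩
      have hev := eventually_nhdsWithin_iff.1 (hfr y hyf)
      obtain ⟨z, hz, hz'⟩ := mem_closure_iff_nhds.1 hy _ hev
      exact absurd hz'.2 (not_le.2 (hz hz'.1))
  have hcompact : IsCompact {x ∈ Ω | φ x₀ ≤ φ x} :=
    Metric.isCompact_of_isClosed_isBounded hclosed (hΩb.subset (Set.sep_subset _ _))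
  obtain ⟨x, hx, hxmax⟩ := hcompact.exists_isMaxOn ⟨x₀, hx₀, le_rfl⟩
    (hφ.mono (Set.sep_subset _ _))
  refine ⟨x, hx.1, fun y hy => ?_⟩
  rcases le_total (φ x₀) (φ y) with h | h
  · exact hxmax ⟨hy, h⟩
  · exact h.trans hx.2

/-- Frontier points of an open set touched by a ball from inside are dense in the frontier. -/
theorem exists_uniqueDiffWithinAt_mem_frontier {E : Type*} [NormedAddCommGroup E]
    [NormedSpace ℝ E] [ProperSpace E] {Ω : Set E} (hΩ : IsOpen Ω) {y : E} (hy : y ∈ frontier Ω)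
    {U : Set E} (hU : U ∈ 𝓝 y) :
    ∃ z ∈ frontier Ω ∩ U, UniqueDiffWithinAt ℝ (closure Ω) z := by
  obtain ⟨r, hr, hrU⟩ := Metric.mem_nhds_iff.1 hU
  obtain ⟨x, hxΩ, hxy⟩ := Metric.mem_closure_iff.1 hy.1 (r / 2) (by positivity)
  obtain ⟨z, hz, hzd⟩ := (isClosed_frontier (s := Ω)).exists_infDist_eq_dist ⟨y, hy⟩ x
  have hle : dist x z ≤ dist x y := hzd ▸ Metric.infDist_le_dist_of_mem hy
  have hxf : x ∉ frontier Ω := fun h => by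
    rw [hΩ.frontier_eq] at h
    exact h.2 hxΩ
  have hpos : 0 < dist x z := dist_pos.2 fun h => hxf (h ▸ hz)
  have hdisj : Disjoint (Metric.ball x (dist x z)) (frontier Ω) := by
    rw [← hzd]
    exact Metric.disjoint_ball_infDist
  have hsub : Metric.ball x (dist x z) ⊆ Ω := by
    refine (convex_ball x (dist x z)).isPreconnected.subset_left_of_subset_union hΩ
      isClosed_closure.isOpen_compl (Set.disjoint_compl_right_iff_subset.2 subset_closure) ?_
      ⟨x, Metric.mem_ball_self hpos, hxΩ⟩
    intro w hw
    by_contra! hwn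
    rw [Set.mem_union, not_or, Set.notMem_compl_iff] at hwn
    exact Set.disjoint_left.1 hdisj hw (by rw [hΩ.frontier_eq]; exact ⟨hwn.2, hwn.1⟩)
  refine ⟨z, ⟨hz, hrU ?_⟩, ?_⟩
  · rw [Metric.mem_ball, dist_comm]
    have h1 := dist_triangle y x z
    rw [dist_comm x y] at hle
    linarith
  · refine (uniqueDiffWithinAt_convex (convex_ball x (dist x z)) ?_ ?_).mono
      (hsub.trans subset_closure)
    · rw [Metric.isOpen_ball.interior_eq]
      exact ⟨x, Metric.mem_ball_self hpos⟩
    · rw [closure_ball _ hpos.ne', Metric.mem_closedBall, dist_comm]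

/-- An upper bound for `gradSqW` on the frontier bounds the limits of `|∇ζ|²` from inside, even
though `fderivWithin` is only meaningful at those frontier points where derivatives are unique. -/
theorem eventually_gradSqW_lt {Ω : Set (EuclideanSpace ℝ (Fin 2))} (hΩ : IsOpen Ω)
    {ζ : EuclideanSpace ℝ (Fin 2) → ℝ} (hζ : ContDiffOn ℝ 1 ζ (closure Ω)) {m c : ℝ} (hmc : m < c)
    (hm : ∀ z ∈ frontier Ω, gradSqW (closure Ω) ζ z ≤ m)
    {y : EuclideanSpace ℝ (Fin 2)} (hy : y ∈ frontier Ω) :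
    ∀ᶠ x in 𝓝[Ω] y, gradSqW (closure Ω) ζ x < c := by
  have hyc : y ∈ closure Ω := hy.1
  obtain ⟨s, hs, hsub, -, f', hf', hcont⟩ :=
    (contDiffWithinAt_succ_iff_hasFDerivWithinAt' (n := 0) (by norm_num)).1
      (by simpa using hζ y hyc : ContDiffWithinAt ℝ (0 + 1) ζ (closure Ω) y)
  rw [Set.insert_eq_of_mem hyc] at hs hsub
  have hgc : ContinuousWithinAt (fun x => ∑ i : Fin 2, (f' x (EuclideanSpace.single i 1)) ^ 2)
      (closure Ω) y := by
    have := hcont.continuousWithinAt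
    simp only [Fin.sum_univ_two]
    fun_prop
  have heq : ∀ z ∈ s, UniqueDiffWithinAt ℝ (closure Ω) z →
      gradSqW (closure Ω) ζ z = ∑ i : Fin 2, (f' z (EuclideanSpace.single i 1)) ^ 2 := by
    intro z hz hzu
    simp only [gradSqW, pdW, (hf' z hz).fderivWithin hzu]
  have hlim : ∑ i : Fin 2, (f' y (EuclideanSpace.single i 1)) ^ 2 ≤ m := by
    by_contra! hlt
    have hev := (hgc.eventually_const_lt hlt).and hs
    rw [eventually_nhdsWithin_iff] at hev
    obtain ⟨z, ⟨hzf, hz⟩, hzu⟩ := exists_uniqueDiffWithinAt_mem_frontier hΩ hy hev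
    obtain ⟨h1, h2⟩ := hz hzf.1
    have := hm z hzf
    rw [heq z h2 hzu] at this
    exact absurd this (not_le.2 h1)
  have hev := nhdsWithin_mono y subset_closure
    ((hgc.eventually_lt_const (hlim.trans_lt hmc)).and hs)
  filter_upwards [hev, self_mem_nhdsWithin] with z hz hzΩ
  rw [heq z hz.2 (hΩ.uniqueDiffWithinAt hzΩ |>.mono subset_closure)]
  exact hz.1

theorem pdW_closure_eq {Ω : Set (EuclideanSpace ℝ (Fin 2))} (hΩ : IsOpen Ω)
    (f : EuclideanSpace ℝ (Fin 2) → ℝ) {x : EuclideanSpace ℝ (Fin 2)} (hx : x ∈ Ω) (i : Fin 2) :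
    pdW (closure Ω) i f x = partialDeriv i f x := by
  rw [pdW, fderivWithin_of_mem_nhds (mem_of_superset (hΩ.mem_nhds hx) subset_closure),
    partialDeriv]

theorem gradSqW_closure_eq {Ω : Set (EuclideanSpace ℝ (Fin 2))} (hΩ : IsOpen Ω)
    (f : EuclideanSpace ℝ (Fin 2) → ℝ) {x : EuclideanSpace ℝ (Fin 2)} (hx : x ∈ Ω) :
    gradSqW (closure Ω) f x = partialDeriv 0 f x ^ 2 + partialDeriv 1 f x ^ 2 := by
  simp [gradSqW, Fin.sum_univ_two, pdW_closure_eq hΩ f hx]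

theorem gradSqW_le_of_frontier {Ω : Set (EuclideanSpace ℝ (Fin 2))}
    (hΩ : IsOpen Ω) (hΩb : Bornology.IsBounded Ω)
    {ζ : EuclideanSpace ℝ (Fin 2) → ℝ}
    (hζ1 : ContDiffOn ℝ 1 ζ (closure Ω)) (hζ3 : ContDiffOn ℝ 3 ζ Ω)
    (hpde : ∀ x ∈ Ω,
      (1 - gradSqW (closure Ω) ζ x) * (∑ i, pdW (closure Ω) i (pdW (closure Ω) i ζ) x) -
        ∑ i, pdW (closure Ω) i (gradSqW (closure Ω) ζ) x * pdW (closure Ω) i ζ x = 0)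
    (hgrad : ∀ x ∈ Ω, gradSqW (closure Ω) ζ x < 1 / 3) {m : ℝ}
    (hm : ∀ z ∈ frontier Ω, gradSqW (closure Ω) ζ z ≤ m)
    {x : EuclideanSpace ℝ (Fin 2)} (hx : x ∈ Ω) : gradSqW (closure Ω) ζ x ≤ m := by
  by_contra! hlt
  have hg : ∀ y ∈ Ω, gradSqW (closure Ω) ζ y = partialDeriv 0 ζ y ^ 2 + partialDeriv 1 ζ y ^ 2 :=
    fun y hy => gradSqW_closure_eq hΩ ζ hy
  have hpde' : ∀ y ∈ Ω,
      (1 - (partialDeriv 0 ζ y ^ 2 + partialDeriv 1 ζ y ^ 2)) *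
          (partialDeriv 0 (partialDeriv 0 ζ) y + partialDeriv 1 (partialDeriv 1 ζ) y) -
        (partialDeriv 0 (fun z => partialDeriv 0 ζ z ^ 2 + partialDeriv 1 ζ z ^ 2) y *
            partialDeriv 0 ζ y +
          partialDeriv 1 (fun z => partialDeriv 0 ζ z ^ 2 + partialDeriv 1 ζ z ^ 2) y *
            partialDeriv 1 ζ y) = 0 := by
    intro y hy
    have hmem : ∀ᶠ z in 𝓝 y, z ∈ Ω := hΩ.mem_nhds hy
    have h1 : ∀ i, pdW (closure Ω) i ζ =ᶠ[𝓝 y] partialDeriv i ζ := fun i =>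
      hmem.mono fun z hz => pdW_closure_eq hΩ ζ hz i
    have h2 : gradSqW (closure Ω) ζ =ᶠ[𝓝 y]
        fun z => partialDeriv 0 ζ z ^ 2 + partialDeriv 1 ζ z ^ 2 := hmem.mono hg
    have := hpde y hy
    simpa only [Fin.sum_univ_two, pdW_closure_eq hΩ _ hy, hg y hy, (h1 _).partialDeriv_eq,
      h2.partialDeriv_eq] using this
  have hcont : ContinuousOn (gradSqW (closure Ω) ζ) Ω := by
    have h0 := (hζ3.partialDeriv (m := 2) hΩ (by norm_num) 0).continuousOn
    have h1 := (hζ3.partialDeriv (m := 2) hΩ (by norm_num) 1).continuousOn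
    exact ((h0.pow 2).add (h1.pow 2)).congr hg
  obtain ⟨x₀, hx₀, hmax₀⟩ := exists_isMaxOn_of_lt_near_frontier hΩ hΩb hcont hx
    fun y hy => eventually_gradSqW_lt hΩ hζ1 hlt hm hy
  set M := gradSqW (closure Ω) ζ x₀ with hM
  have hmM : m < M := hlt.trans_le (hmax₀ hx)
  have hM3 : M < 1 / 3 := hgrad x₀ hx₀
  obtain ⟨R, hR⟩ : ∃ R, ∀ y ∈ Ω, ‖y‖ ≤ R := hΩb.exists_norm_le
  have hnorm : ∀ y : EuclideanSpace ℝ (Fin 2), y 0 ^ 2 + y 1 ^ 2 = ‖y‖ ^ 2 := fun y => by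
    simp [EuclideanSpace.norm_sq_eq, Fin.sum_univ_two]
  have hR' : ∀ y ∈ Ω, y 0 ^ 2 + y 1 ^ 2 ≤ R ^ 2 := fun y hy => by
    rw [hnorm]
    exact pow_le_pow_left₀ (norm_nonneg y) (hR y hy) 2
  obtain ⟨ε, hε, hε'⟩ : ∃ ε : ℝ, 0 < ε ∧ ε * R ^ 2 < min (M - m) ((1 - 3 * M) ^ 2) := by
    have hpos : 0 < min (M - m) ((1 - 3 * M) ^ 2) :=
      lt_min (by linarith) (pow_pos (by linarith) 2)
    refine ⟨min (M - m) ((1 - 3 * M) ^ 2) / (R ^ 2 + 1), by positivity, ?_⟩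
    rw [div_mul_eq_mul_div, div_lt_iff₀ (by positivity)]
    linarith
  have hεm : ε * R ^ 2 < M - m := hε'.trans_le (min_le_left _ _)
  have hεM : ε * R ^ 2 < (1 - 3 * M) ^ 2 := hε'.trans_le (min_le_right _ _)
  have hεR : ∀ y ∈ Ω, ε * (y 0 ^ 2 + y 1 ^ 2) ≤ ε * R ^ 2 := fun y hy =>
    mul_le_mul_of_nonneg_left (hR' y hy) hε.le
  obtain ⟨x₁, hx₁, hmax₁⟩ := exists_isMaxOn_of_lt_near_frontier hΩ hΩb
    (φ := fun y => gradSqW (closure Ω) ζ y + ε * (y 0 ^ 2 + y 1 ^ 2))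
    (hcont.add (by fun_prop)) hx₀ (by
      intro y hy
      filter_upwards [eventually_gradSqW_lt hΩ hζ1 (c := M - ε * R ^ 2) (by linarith) hm hy,
        self_mem_nhdsWithin] with z hz hzΩ
      have h1 := hεR z hzΩ
      have h2 : 0 ≤ ε * (x₀ 0 ^ 2 + x₀ 1 ^ 2) := by positivity
      linarith)
  have hloc : IsLocalMax (fun y => partialDeriv 0 ζ y ^ 2 + partialDeriv 1 ζ y ^ 2 +
      ε * (y 0 ^ 2 + y 1 ^ 2)) x₁ := by
    filter_upwards [hΩ.mem_nhds hx₁] with y hy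
    have : gradSqW (closure Ω) ζ y + ε * (y 0 ^ 2 + y 1 ^ 2) ≤
      gradSqW (closure Ω) ζ x₁ + ε * (x₁ 0 ^ 2 + x₁ 1 ^ 2) := hmax₁ hy
    rwa [hg y hy, hg x₁ hx₁] at this
  have hfin := bernstein_at_max hΩ hζ3 hpde' hx₁ hε hloc (hg x₁ hx₁ ▸ hgrad x₁ hx₁)
  rw [← hg x₁ hx₁] at hfin
  have h1 : gradSqW (closure Ω) ζ x₁ ≤ M := hmax₀ hx₁
  have h2 : (1 - 3 * M) ^ 2 ≤ (1 - 3 * gradSqW (closure Ω) ζ x₁) ^ 2 :=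
    pow_le_pow_left₀ (by linarith) (by linarith) 2
  have h3 := hεR x₁ hx₁
  linarith

/-- Maximum principle: for a bounded open `Ω ⊆ ℝ²` and `ζ` which is `C¹` on `closure Ω`
and `C³` on `Ω`, satisfying `(1 - ‖∇ζ‖²)Δζ - ⟨∇(‖∇ζ‖²), ∇ζ⟩ = 0` on `Ω` and
`‖∇ζ‖ < 1/√3` on `closure Ω`, the supremum of `‖∇ζ‖` over `closure Ω` is attained
on the boundary `∂Ω`. -/
theorem gradient_max_on_boundary (Ω : Set (EuclideanSpace ℝ (Fin 2)))
    (hΩ : IsOpen Ω) (hΩb : Bornology.IsBounded Ω)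
    (ζ : EuclideanSpace ℝ (Fin 2) → ℝ)
    (hζ1 : ContDiffOn ℝ 1 ζ (closure Ω)) (hζ3 : ContDiffOn ℝ 3 ζ Ω)
    (hpde : ∀ x ∈ Ω,
      (1 - gradSqW (closure Ω) ζ x) * (∑ i, pdW (closure Ω) i (pdW (closure Ω) i ζ) x) -
        ∑ i, pdW (closure Ω) i (gradSqW (closure Ω) ζ) x * pdW (closure Ω) i ζ x = 0)
    (hgrad : ∀ x ∈ closure Ω,
      Real.sqrt (gradSqW (closure Ω) ζ x) < 1 / Real.sqrt 3) :
    sSup ((fun x => Real.sqrt (gradSqW (closure Ω) ζ x)) '' closure Ω) =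
      sSup ((fun x => Real.sqrt (gradSqW (closure Ω) ζ x)) '' frontier Ω) := by
  have hnonneg : ∀ x, 0 ≤ gradSqW (closure Ω) ζ x := fun x =>
    Finset.sum_nonneg fun i _ => sq_nonneg _
  rcases Ω.eq_empty_or_nonempty with rfl | hne
  · simp
  have hfr : (frontier Ω).Nonempty := nonempty_frontier_iff.2
    ⟨hne, fun h => NormedSpace.unbounded_univ ℝ (EuclideanSpace ℝ (Fin 2)) (h ▸ hΩb)⟩
  have hbdd : BddAbove ((fun x => Real.sqrt (gradSqW (closure Ω) ζ x)) '' closure Ω) := by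
    refine ⟨1 / Real.sqrt 3, ?_⟩
    rintro _ ⟨x, hx, rfl⟩
    exact (hgrad x hx).le
  have hsub := Set.image_mono (f := fun x => Real.sqrt (gradSqW (closure Ω) ζ x))
    (frontier_subset_closure (s := Ω))
  refine le_antisymm (csSup_le (hne.closure.image _) ?_)
    (csSup_le_csSup hbdd (hfr.image _) hsub)
  have hle : ∀ z ∈ frontier Ω, Real.sqrt (gradSqW (closure Ω) ζ z) ≤
      sSup ((fun x => Real.sqrt (gradSqW (closure Ω) ζ x)) '' frontier Ω) := fun z hz =>
    le_csSup (hbdd.mono hsub) ⟨z, hz, rfl⟩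
  have hS : 0 ≤ sSup ((fun x => Real.sqrt (gradSqW (closure Ω) ζ x)) '' frontier Ω) :=
    (Real.sqrt_nonneg _).trans (hle _ hfr.choose_spec)
  rintro _ ⟨x, hx, rfl⟩
  by_cases hxΩ : x ∈ Ω
  · refine Real.sqrt_le_iff.2 ⟨hS, gradSqW_le_of_frontier hΩ hΩb hζ1 hζ3 hpde ?_ ?_ hxΩ⟩
    · intro y hy
      have := hgrad y (subset_closure hy)
      rw [one_div, ← Real.sqrt_inv, Real.sqrt_lt_sqrt_iff (hnonneg y)] at this
      simpa using this
    · exact fun z hz => (Real.sqrt_le_iff.1 (hle z hz)).2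
  · exact hle x (by rw [hΩ.frontier_eq]; exact ⟨hx, hxΩ⟩)
end

section
/- The function g : ℝ² → ℝ defined by g(p) = −(1/4)(1 − ‖p‖²)² is convex on the closed ball {p ∈ ℝ² : ‖p‖ ≤ 1/√3} and strictly convex on the open ball {p ∈ ℝ² : ‖p‖ < 1/√3}. -/
/-- In a strictly convex space, a strictly convex and strictly increasing radial profile on `[0, r]`
gives a strictly convex radial function on the closed ball of radius `r`. -/
theorem StrictConvexOn.comp_norm_closedBall {E : Type*} [NormedAddCommGroup E] [NormedSpace ℝ E]
    [StrictConvexSpace ℝ E] {r : ℝ} {f : ℝ → ℝ} (hf : StrictConvexOn ℝ (Set.Icc 0 r) f)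
    (hmono : StrictMonoOn f (Set.Icc 0 r)) :
    StrictConvexOn ℝ (Metric.closedBall (0 : E) r) (fun x => f ‖x‖) := by
  have mem_Icc {z : E} (hz : z ∈ Metric.closedBall (0 : E) r) : ‖z‖ ∈ Set.Icc 0 r :=
    ⟨norm_nonneg z, mem_closedBall_zero_iff.1 hz⟩
  refine ⟨convex_closedBall 0 r, fun x hx y hy hxy a b ha hb hab => ?_⟩
  have hz := mem_Icc (convex_closedBall (0 : E) r hx hy ha.le hb.le hab)
  rcases eq_or_ne ‖x‖ ‖y‖ with h | h
  · have hlt : ‖a • x + b • y‖ < ‖y‖ := norm_combo_lt_of_ne h.le le_rfl hxy ha hb hab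
    calc f ‖a • x + b • y‖ < f ‖y‖ := hmono hz (mem_Icc hy) hlt
      _ = a • f ‖x‖ + b • f ‖y‖ := by rw [h, ← add_smul, hab, one_smul]
  · have hle : ‖a • x + b • y‖ ≤ a • ‖x‖ + b • ‖y‖ := by
      simpa [norm_smul, abs_of_pos ha, abs_of_pos hb] using norm_add_le (a • x) (b • y)
    calc f ‖a • x + b • y‖ ≤ f (a • ‖x‖ + b • ‖y‖) :=
          hmono.monotoneOn hz (hf.1 (mem_Icc hx) (mem_Icc hy) ha.le hb.le hab) hle
      _ < a • f ‖x‖ + b • f ‖y‖ := hf.2 (mem_Icc hx) (mem_Icc hy) h ha hb hab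

theorem three_mul_sq_lt_one_of_lt_one_div_sqrt_three {t : ℝ} (h0 : 0 < t)
    (ht : t < 1 / Real.sqrt 3) : 3 * t ^ 2 < 1 := by
  have h := pow_lt_pow_left₀ ht h0.le two_ne_zero
  rw [div_pow, Real.sq_sqrt (by norm_num)] at h
  linarith

theorem deriv_neg_quarter_mul_one_sub_sq_sq :
    deriv (fun t : ℝ => -(1 / 4) * (1 - t ^ 2) ^ 2) = fun t => t - t ^ 3 := by
  ext t
  refine HasDerivAt.deriv ?_
  refine ((((hasDerivAt_pow 2 t).const_sub 1).pow 2).const_mul (-(1 / 4) : ℝ)).congr_deriv ?_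
  norm_num
  ring

theorem strictMonoOn_neg_quarter_mul_one_sub_sq_sq :
    StrictMonoOn (fun t : ℝ => -(1 / 4) * (1 - t ^ 2) ^ 2) (Set.Icc 0 (1 / Real.sqrt 3)) := by
  refine strictMonoOn_of_deriv_pos (convex_Icc _ _) (by fun_prop) fun t ht => ?_
  rw [interior_Icc] at ht
  rw [deriv_neg_quarter_mul_one_sub_sq_sq]
  have h := three_mul_sq_lt_one_of_lt_one_div_sqrt_three ht.1 ht.2
  have h' : 0 < t * (1 - t ^ 2) := mul_pos ht.1 (by nlinarith)
  linarith

theorem strictConvexOn_neg_quarter_mul_one_sub_sq_sq :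
    StrictConvexOn ℝ (Set.Icc 0 (1 / Real.sqrt 3))
      (fun t : ℝ => -(1 / 4) * (1 - t ^ 2) ^ 2) := by
  refine strictConvexOn_of_deriv2_pos (convex_Icc _ _) (by fun_prop) fun t ht => ?_
  rw [interior_Icc] at ht
  have hderiv : HasDerivAt (fun s : ℝ => s - s ^ 3) (1 - 3 * t ^ 2) t :=
    (hasDerivAt_id' t).sub (hasDerivAt_pow 3 t)
  rw [Function.iterate_succ_apply, Function.iterate_one, deriv_neg_quarter_mul_one_sub_sq_sq,
    hderiv.deriv]
  linarith [three_mul_sq_lt_one_of_lt_one_div_sqrt_three ht.1 ht.2]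

/-- The function `g(p) = -(1/4)(1 - ‖p‖²)²` is convex on the closed ball of radius
`1/√3` and strictly convex on the open ball of radius `1/√3` in ℝ². -/
theorem convexity_of_outer_integrand :
    ConvexOn ℝ (Metric.closedBall (0 : EuclideanSpace ℝ (Fin 2)) (1 / Real.sqrt 3))
        (fun p : EuclideanSpace ℝ (Fin 2) => -(1 / 4) * (1 - ‖p‖ ^ 2) ^ 2) ∧
      StrictConvexOn ℝ (Metric.ball (0 : EuclideanSpace ℝ (Fin 2)) (1 / Real.sqrt 3))
        (fun p : EuclideanSpace ℝ (Fin 2) => -(1 / 4) * (1 - ‖p‖ ^ 2) ^ 2) := by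
  have h : StrictConvexOn ℝ (Metric.closedBall (0 : EuclideanSpace ℝ (Fin 2)) (1 / Real.sqrt 3))
      (fun p : EuclideanSpace ℝ (Fin 2) => -(1 / 4) * (1 - ‖p‖ ^ 2) ^ 2) :=
    strictConvexOn_neg_quarter_mul_one_sub_sq_sq.comp_norm_closedBall
      strictMonoOn_neg_quarter_mul_one_sub_sq_sq
  exact ⟨h.convexOn, h.subset Metric.ball_subset_closedBall (convex_ball _ _)⟩
end

section
/- Let V : ℝ → ℝ satisfy 2/3 < V(t) ≤ 1 for all t ∈ ℝ, let j_r < 0, and let w : [0,∞) → ℝ be twice continuously differentiable with w''(η) = V(w'(η))·w(η) for all η ≥ 0, w'(0) = j_r, and w(η) → 0 as η → ∞. Then: (i) w(η) ≥ 0 for all η ≥ 0; (ii) j_r ≤ w'(η) ≤ 0 for all η ≥ 0; (iii) w(0) < −√(3/2)·j_r; and (iv) w(η) ≤ w(0)·e^{−√(2/3)·η} for all η ≥ 0. -/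
/-- A function on `[a, ∞)` with nonnegative one-sided derivative is monotone there. -/
lemma monotoneOn_Ici_of_hasDerivWithinAt_nonneg {f f' : ℝ → ℝ} {a : ℝ}
    (hf : ∀ x ≥ a, HasDerivWithinAt f (f' x) (Set.Ici a) x) (hf' : ∀ x ≥ a, 0 ≤ f' x) :
    MonotoneOn f (Set.Ici a) := by
  refine monotoneOn_of_hasDerivWithinAt_nonneg (f' := f') (convex_Ici a)
    (fun x hx ↦ (hf x hx).continuousWithinAt) (fun x hx ↦ ?_) (fun x hx ↦ ?_)
  · exact (hf x (interior_subset hx)).mono interior_subset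
  · exact hf' x (interior_subset hx)

/-- A function which is monotone on `[a, ∞)` lies below its limit at infinity. -/
lemma MonotoneOn.le_of_tendsto_atTop_Ici {f : ℝ → ℝ} {a l x : ℝ} (hf : MonotoneOn f (Set.Ici a))
    (hl : Filter.Tendsto f Filter.atTop (nhds l)) (hx : a ≤ x) : f x ≤ l := by
  refine ge_of_tendsto hl ?_
  filter_upwards [Filter.eventually_ge_atTop x] with y hy
  exact hf hx (hx.trans hy) hy


/-- Qualitative analysis of the reduced boundary-layer equation `w'' = V(w')·w` on
`[0,∞)` with `2/3 < V ≤ 1`, `w'(0) = j_r < 0` and `w → 0` at infinity: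
`w ≥ 0`, `j_r ≤ w' ≤ 0`, `w(0) < -√(3/2)·j_r` and `w(η) ≤ w(0)·e^{-√(2/3)η}`. -/
theorem boundary_layer_qualitative (V : ℝ → ℝ)
    (hV : ∀ t : ℝ, 2 / 3 < V t ∧ V t ≤ 1)
    (jr : ℝ) (hjr : jr < 0) (w : ℝ → ℝ)
    (hw : ContDiffOn ℝ 2 w (Set.Ici (0 : ℝ)))
    (hode : ∀ η ≥ (0 : ℝ),
      derivWithin (derivWithin w (Set.Ici (0 : ℝ))) (Set.Ici (0 : ℝ)) η =
        V (derivWithin w (Set.Ici (0 : ℝ)) η) * w η)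
    (hw0 : derivWithin w (Set.Ici (0 : ℝ)) 0 = jr)
    (hlim : Filter.Tendsto w Filter.atTop (nhds 0)) :
    (∀ η ≥ (0 : ℝ), 0 ≤ w η) ∧
    (∀ η ≥ (0 : ℝ), jr ≤ derivWithin w (Set.Ici (0 : ℝ)) η ∧
      derivWithin w (Set.Ici (0 : ℝ)) η ≤ 0) ∧
    w 0 < -Real.sqrt (3 / 2) * jr ∧
    (∀ η ≥ (0 : ℝ), w η ≤ w 0 * Real.exp (-Real.sqrt (2 / 3) * η)) := by
  have hmem : ∀ x : ℝ, x ≥ 0 → x ∈ Set.Ici (0 : ℝ) := fun x hx ↦ hx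
  have hw' : ContDiffOn ℝ 1 (derivWithin w (Set.Ici (0 : ℝ))) (Set.Ici (0 : ℝ)) :=
    hw.derivWithin (uniqueDiffOn_Ici 0) (by norm_num)
  have hdw : ∀ x ≥ (0 : ℝ),
      HasDerivWithinAt w (derivWithin w (Set.Ici (0 : ℝ)) x) (Set.Ici 0) x := fun x hx ↦
    (hw.differentiableOn (by norm_num) x hx).hasDerivWithinAt
  have hdu : ∀ x ≥ (0 : ℝ), HasDerivWithinAt (derivWithin w (Set.Ici (0 : ℝ)))
      (V (derivWithin w (Set.Ici (0 : ℝ)) x) * w x) (Set.Ici 0) x := fun x hx ↦ by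
    rw [← hode x hx]
    exact (hw'.differentiableOn (by norm_num) x hx).hasDerivWithinAt
  generalize derivWithin w (Set.Ici (0 : ℝ)) = u at hdw hdu hw0 ⊢
  have hpmono : MonotoneOn (fun x ↦ w x * u x) (Set.Ici 0) := by
    refine monotoneOn_Ici_of_hasDerivWithinAt_nonneg
      (fun x hx ↦ (hdw x hx).mul (hdu x hx)) (fun x hx ↦ ?_)
    nlinarith [(hV (u x)).1, sq_nonneg (u x), mul_nonneg (sub_nonneg.2 (hV (u x)).1.le)
      (sq_nonneg (w x)), sq_nonneg (w x)]
  have hdsq : ∀ x ≥ (0 : ℝ),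
      HasDerivWithinAt (fun x ↦ w x ^ 2) (2 * (w x * u x)) (Set.Ici 0) x := fun x hx ↦ by
    refine ((hdw x hx).pow 2).congr_deriv ?_
    norm_num
    ring
  have hp : ∀ x ≥ (0 : ℝ), w x * u x ≤ 0 := by
    intro a ha
    by_contra! hpos
    have hmono : MonotoneOn (fun x ↦ w x ^ 2) (Set.Ici a) := by
      refine monotoneOn_Ici_of_hasDerivWithinAt_nonneg
        (fun x hx ↦ (hdsq x (ha.trans hx)).mono (Set.Ici_subset_Ici.2 ha)) (fun x hx ↦ ?_)
      have := hpmono (hmem a ha) (hmem x (ha.trans hx)) hx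
      dsimp only at this
      linarith
    have h0 := hmono.le_of_tendsto_atTop_Ici (by simpa using hlim.pow 2) le_rfl
    have : w a = 0 := by nlinarith
    simp [this] at hpos
  have hsq : ∀ x ≥ (0 : ℝ), ∀ y ≥ x, w y ^ 2 ≤ w x ^ 2 := by
    have : MonotoneOn (fun x ↦ -w x ^ 2) (Set.Ici 0) :=
      monotoneOn_Ici_of_hasDerivWithinAt_nonneg (fun x hx ↦ (hdsq x hx).neg)
        (fun x hx ↦ by linarith [hp x hx])
    intro x hx y hy
    have := this (hmem x hx) (hmem y (hx.trans hy)) hy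
    dsimp only at this
    linarith
  have hzero : ∀ x ≥ (0 : ℝ), w x = 0 → ∀ y ≥ x, w y = 0 := by
    intro x hx h0 y hy
    have := hsq x hx y hy
    rw [h0] at this
    nlinarith
  have huniq : UniqueDiffWithinAt ℝ (Set.Ici (0 : ℝ)) 0 := uniqueDiffOn_Ici 0 0 (hmem 0 le_rfl)
  have hwpos : 0 < w 0 := by
    have h0 : 0 ≤ w 0 := by
      have := hp 0 le_rfl
      rw [hw0] at this
      nlinarith
    refine h0.lt_of_ne fun h ↦ ?_
    have hc : HasDerivWithinAt w 0 (Set.Ici 0) 0 :=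
      (hasDerivWithinAt_const 0 (Set.Ici 0) (0 : ℝ)).congr
        (fun x hx ↦ hzero 0 le_rfl h.symm x hx) h.symm
    have := huniq.eq_deriv _ (hdw 0 le_rfl) hc
    linarith
  have hcont : ContinuousOn w (Set.Ici 0) := fun x hx ↦ (hdw x hx).continuousWithinAt
  have hnonneg : ∀ x ≥ (0 : ℝ), 0 ≤ w x := by
    intro b hb
    by_contra! hneg
    obtain ⟨a, ha, ha0⟩ := intermediate_value_Icc' hb
      (hcont.mono Set.Icc_subset_Ici_self) ⟨hneg.le, hwpos.le⟩
    have := hzero a ha.1 ha0 b ha.2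
    linarith
  have humono : MonotoneOn u (Set.Ici 0) :=
    monotoneOn_Ici_of_hasDerivWithinAt_nonneg hdu fun x hx ↦
      mul_nonneg (by linarith [(hV (u x)).1]) (hnonneg x hx)
  have hu : ∀ x ≥ (0 : ℝ), u x ≤ 0 := by
    intro a ha
    by_contra! hpos
    have hmono : MonotoneOn w (Set.Ici a) :=
      monotoneOn_Ici_of_hasDerivWithinAt_nonneg
        (fun x hx ↦ (hdw x (ha.trans hx)).mono (Set.Ici_subset_Ici.2 ha))
        (fun x hx ↦ hpos.le.trans (humono (hmem a ha) (hmem x (ha.trans hx)) hx))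
    have hwz : ∀ x ≥ a, w x = 0 := fun x hx ↦
      le_antisymm (hmono.le_of_tendsto_atTop_Ici hlim hx) (hnonneg x (ha.trans hx))
    have hc : HasDerivWithinAt w 0 (Set.Ici a) a :=
      (hasDerivWithinAt_const a (Set.Ici a) (0 : ℝ)).congr hwz (hwz a le_rfl)
    have := (uniqueDiffOn_Ici a a Set.self_mem_Ici).eq_deriv _
      ((hdw a ha).mono (Set.Ici_subset_Ici.2 ha)) hc
    linarith
  have hcpos : 0 < √(2 / 3 : ℝ) := by positivity
  have hcsq : √(2 / 3 : ℝ) ^ 2 = 2 / 3 := Real.sq_sqrt (by norm_num)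
  have hcinv : √(3 / 2 : ℝ) * √(2 / 3 : ℝ) = 1 := by
    rw [← Real.sqrt_mul (by norm_num)]
    norm_num
  generalize √(2 / 3 : ℝ) = c at hcpos hcsq hcinv ⊢
  have hdexp : ∀ k x : ℝ, HasDerivWithinAt (fun x ↦ Real.exp (k * x)) (Real.exp (k * x) * k)
      (Set.Ici 0) x := fun k x ↦ by
    simpa using (((hasDerivAt_id x).const_mul k).exp).hasDerivWithinAt
  have hdg : ∀ x ≥ (0 : ℝ), HasDerivWithinAt (fun x ↦ u x + c * w x)
      (V (u x) * w x + c * u x) (Set.Ici 0) x := fun x hx ↦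
    (hdu x hx).add ((hdw x hx).const_mul c)
  have hgmono : MonotoneOn (fun x ↦ (u x + c * w x) * Real.exp (-c * x)) (Set.Ici 0) := by
    refine monotoneOn_Ici_of_hasDerivWithinAt_nonneg
      (fun x hx ↦ (hdg x hx).mul (hdexp (-c) x)) (fun x hx ↦ ?_)
    have h : 0 ≤ (V (u x) - 2 / 3) * w x * Real.exp (-c * x) :=
      mul_nonneg (mul_nonneg (by linarith [(hV (u x)).1]) (hnonneg x hx)) (Real.exp_pos _).le
    rw [← hcsq] at h
    linarith
  have hg : ∀ x ≥ (0 : ℝ), u x + c * w x ≤ 0 := by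
    intro x hx
    have h : (u x + c * w x) * Real.exp (-c * x) ≤ 0 := by
      refine ge_of_tendsto (by simpa using hlim.const_mul c) ?_
      filter_upwards [Filter.eventually_ge_atTop x] with y hy
      have hy0 : 0 ≤ y := hx.trans hy
      have hexp : Real.exp (-c * y) ≤ 1 := Real.exp_le_one_iff.2 (by nlinarith)
      have hcw : 0 ≤ c * w y := mul_nonneg hcpos.le (hnonneg y hy0)
      refine (hgmono (hmem x hx) (hmem y hy0) hy).trans ?_
      dsimp only
      nlinarith [Real.exp_pos (-c * y), hu y hy0,
        mul_nonneg (neg_nonneg.2 (hu y hy0)) (Real.exp_pos (-c * y)).le]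
    exact nonpos_of_mul_nonpos_left h (Real.exp_pos _)
  have hg0 : u 0 + c * w 0 < 0 := by
    refine (hg 0 le_rfl).lt_of_ne fun h ↦ ?_
    have hgz : ∀ x ≥ (0 : ℝ), u x + c * w x = 0 := by
      intro x hx
      have h1 := hgmono (hmem 0 le_rfl) (hmem x hx) hx
      simp only [h, zero_mul] at h1
      exact le_antisymm (hg x hx) (nonneg_of_mul_nonneg_left h1 (Real.exp_pos _))
    have hc : HasDerivWithinAt (fun x ↦ u x + c * w x) 0 (Set.Ici 0) 0 :=
      (hasDerivWithinAt_const 0 (Set.Ici 0) (0 : ℝ)).congr hgz h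
    have h2 := huniq.eq_deriv _ (hdg 0 le_rfl) hc
    have h3 : 0 < (V (u 0) - 2 / 3) * w 0 := mul_pos (by linarith [(hV (u 0)).1]) hwpos
    have h4 : c * (u 0 + c * w 0) = 0 := by rw [h, mul_zero]
    rw [← hcsq] at h3
    linarith
  refine ⟨hnonneg, fun x hx ↦ ⟨hw0 ▸ humono (hmem 0 le_rfl) (hmem x hx) hx, hu x hx⟩, ?_, ?_⟩
  · rw [hw0] at hg0
    have hs : 0 < √(3 / 2 : ℝ) := by positivity
    have h1 := mul_neg_of_pos_of_neg hs hg0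
    have h2 : √(3 / 2 : ℝ) * (jr + c * w 0) = √(3 / 2 : ℝ) * jr + w 0 := by
      linear_combination w 0 * hcinv
    linarith
  · intro x hx
    have hanti : MonotoneOn (fun x ↦ -(w x * Real.exp (c * x))) (Set.Ici 0) := by
      refine monotoneOn_Ici_of_hasDerivWithinAt_nonneg
        (fun x hx ↦ ((hdw x hx).mul (hdexp c x)).neg) (fun x hx ↦ ?_)
      have := mul_nonpos_of_nonpos_of_nonneg (hg x hx) (Real.exp_pos (c * x)).le
      linarith
    have h := hanti (hmem 0 le_rfl) (hmem x hx) hx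
    simp only [mul_zero, Real.exp_zero, mul_one, neg_le_neg_iff] at h
    calc w x = w x * Real.exp (c * x) * Real.exp (-c * x) := by
          rw [mul_assoc, ← Real.exp_add]
          simp
      _ ≤ w 0 * Real.exp (-c * x) := mul_le_mul_of_nonneg_right h (Real.exp_pos _).le
end

section
/- Let j_r ≤ 0 with j_r² < 4/27, and let μ_j be the unique number in (√(2/3), 1] with μ_j⁴(1 − μ_j²) = j_r². Then there exist functions μ, θ : [0,∞) → ℝ with θ twice continuously differentiable and μ continuous, such that for all η ≥ 0: (i) 2/3 < μ(η)² ≤ 1; (ii) μ(η)⁴·(1 − μ(η)²) = (θ'(η) − j_r)²; (iii) θ''(η) = μ(η)²·θ(η); (iv) θ'(0) = j_r; (v) θ(η) ≥ 0 and j_r ≤ θ'(η) ≤ 0; (vi) θ(η) ≤ −√(3/2)·j_r·e^{−√(2/3)·η}; and (vii) θ, θ', and μ − μ_j are square-integrable on [0,∞). -/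
open MeasureTheory Set in
/-- A scalar autonomous equation with continuous, positive and bounded right-hand side has a global
solution through every point, here through the origin. -/
theorem exists_global_solution_of_pos_of_le {K : ℝ → ℝ} {C : ℝ} (hK : Continuous K)
    (hpos : ∀ x, 0 < K x) (hC : ∀ x, K x ≤ C) :
    ∃ τ : ℝ → ℝ, τ 0 = 0 ∧ ∀ x, HasDerivAt τ (K (τ x)) x := by
  have hinv : Continuous fun x => (K x)⁻¹ := hK.inv₀ fun x => (hpos x).ne'
  have hC0 : 0 < C := (hpos 0).trans_le (hC 0)
  set T : ℝ → ℝ := fun x => ∫ t in (0 : ℝ)..x, (K t)⁻¹ with hT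
  have hd : ∀ x, HasDerivAt T (K x)⁻¹ x := fun x => hinv.integral_hasStrictDerivAt 0 x |>.hasDerivAt
  have hT0 : T 0 = 0 := by simp [hT]
  have hmono : StrictMono T :=
    strictMono_of_hasDerivAt_pos hd fun x => inv_pos.2 (hpos x)
  have hcont : Continuous T := continuous_iff_continuousAt.2 fun x => (hd x).continuousAt
  have hgrow : Monotone fun x => T x - C⁻¹ * x := by
    refine monotone_of_hasDerivAt_nonneg (f' := fun x => (K x)⁻¹ - C⁻¹ * 1)
      (fun x => (hd x).sub ((hasDerivAt_id x).const_mul _)) fun x => ?_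
    have := inv_anti₀ (hpos x) (hC x)
    simpa using this
  have htop : Filter.Tendsto T Filter.atTop Filter.atTop := by
    refine Filter.tendsto_atTop_mono' _ ?_
      (Filter.tendsto_id.const_mul_atTop (inv_pos.2 hC0))
    filter_upwards [Filter.eventually_ge_atTop 0] with x hx
    have := hgrow hx
    simp only [hT0] at this
    simp only [id]
    linarith
  have hbot : Filter.Tendsto T Filter.atBot Filter.atBot := by
    refine Filter.tendsto_atBot_mono' _ ?_
      (Filter.tendsto_id.const_mul_atBot (inv_pos.2 hC0))
    filter_upwards [Filter.eventually_le_atBot 0] with x hx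
    have := hgrow hx
    simp only [hT0] at this
    simp only [id]
    linarith
  let e : ℝ ≃o ℝ := hmono.orderIsoOfSurjective T (hcont.surjective htop hbot)
  have he : ∀ x, T (e.symm x) = x := fun x => e.apply_symm_apply x
  refine ⟨e.symm, hmono.injective ((he 0).trans hT0.symm), fun x => ?_⟩
  have := HasDerivAt.of_local_left_inverse (f := T) (g := e.symm) (a := x)
    e.symm.continuous.continuousAt (hd _) (inv_pos.2 (hpos _)).ne'
    (Filter.Eventually.of_forall he)
  simpa using this

open MeasureTheory Set in
/-- Decaying solution of `θ' = v`, `v' = G(v) θ` with `v(0) = j < 0`. -/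
theorem exists_decaying_solution {G : ℝ → ℝ} (hG : Continuous G) (hlo : ∀ x, 2 / 3 ≤ G x)
    (hhi : ∀ x, G x ≤ 1) {j : ℝ} (hj : j < 0) :
    ∃ θ v : ℝ → ℝ, (∀ x, HasDerivAt θ (v x) x) ∧ (∀ x, HasDerivAt v (G (v x) * θ x) x) ∧
      v 0 = j ∧ (∀ x, v x < 0) ∧ (∀ x, -v x ≤ θ x) ∧ (∀ x, θ x ≤ √(3 / 2) * -v x) := by
  have hGpos : ∀ x, 0 < G x := fun x => by linarith [hlo x]
  have hint : Continuous fun w => w / G w := continuous_id.div hG fun x => (hGpos x).ne'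
  set H : ℝ → ℝ := fun v => ∫ w in (0 : ℝ)..v, w / G w with hH
  have hd : ∀ x, HasDerivAt H (x / G x) x := fun x =>
    hint.integral_hasStrictDerivAt 0 x |>.hasDerivAt
  have hHcont : Continuous H := continuous_iff_continuousAt.2 fun x => (hd x).continuousAt
  have hH0 : H 0 = 0 := by simp [hH]
  have hHlo : ∀ x ≤ 0, x ^ 2 ≤ 2 * H x := by
    intro x hx
    have hanti : AntitoneOn (fun x => 2 * H x - x ^ 2) (Iic 0) := by
      refine antitoneOn_of_hasDerivWithinAt_nonpos (f' := fun x => 2 * (x / G x) - 2 * x)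
        (convex_Iic 0) (by fun_prop) (fun y _ => ?_) fun y hy => ?_
      · simpa using (((hd y).const_mul 2).fun_sub (hasDerivAt_pow 2 y)).hasDerivWithinAt
      · have hy : y < 0 := by simpa using hy
        have : y / G y ≤ y := by
          rw [div_le_iff₀ (hGpos y)]; nlinarith [hhi y]
        linarith
    have := hanti hx (mem_Iic.2 le_rfl) hx
    simp only [hH0] at this
    linarith
  have hHhi : ∀ x ≤ 0, 2 * H x ≤ 3 / 2 * x ^ 2 := by
    intro x hx
    have hm : MonotoneOn (fun x => 2 * H x - 3 / 2 * x ^ 2) (Iic 0) := by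
      refine monotoneOn_of_hasDerivWithinAt_nonneg
        (f' := fun x => 2 * (x / G x) - 3 / 2 * (2 * x))
        (convex_Iic 0) (by fun_prop) (fun y _ => ?_) fun y hy => ?_
      · simpa using
          (((hd y).const_mul 2).fun_sub ((hasDerivAt_pow 2 y).const_mul (3 / 2))).hasDerivWithinAt
      · have hy : y < 0 := by simpa using hy
        have : 3 / 2 * y ≤ y / G y := by
          rw [le_div_iff₀ (hGpos y)]; nlinarith [hlo y]
        linarith
    have := hm hx (mem_Iic.2 le_rfl) hx
    simp only [hH0] at this
    linarith
  have hslo : ∀ x ≤ 0, -x ≤ √(2 * H x) := fun x hx =>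
    Real.le_sqrt_of_sq_le (by simpa using hHlo x hx)
  have hshi : ∀ x ≤ 0, √(2 * H x) ≤ √(3 / 2) * -x := by
    intro x hx
    refine (Real.sqrt_le_sqrt (hHhi x hx)).trans_eq ?_
    rw [Real.sqrt_mul (by norm_num), Real.sqrt_sq_eq_abs, abs_of_nonpos hx]
  have hneg : ∀ t, j * Real.exp (-t) < 0 := fun t => mul_neg_of_neg_of_pos hj (Real.exp_pos _)
  set K : ℝ → ℝ := fun t => G (j * Real.exp (-t)) * √(2 * H (j * Real.exp (-t))) /
    -(j * Real.exp (-t)) with hKdef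
  obtain ⟨τ, hτ0, hτ⟩ := exists_global_solution_of_pos_of_le (K := K) (C := √(3 / 2))
    (by
      rw [hKdef]
      refine Continuous.div (by fun_prop) (by fun_prop) fun t => ?_
      exact (neg_pos.2 (hneg t)).ne')
    (fun t => by
      have h := hneg t
      have := hslo _ h.le
      exact div_pos (mul_pos (hGpos _) (by linarith)) (by linarith))
    (fun t => by
      have h := hneg t
      rw [hKdef, div_le_iff₀ (by linarith)]
      have := hshi _ h.le
      have h2 := mul_le_mul (hhi (j * Real.exp (-t))) this (Real.sqrt_nonneg _) zero_le_one
      linarith)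
  have hv : ∀ x, HasDerivAt (fun x => j * Real.exp (-τ x))
      (G (j * Real.exp (-τ x)) * √(2 * H (j * Real.exp (-τ x)))) x := by
    intro x
    refine ((hτ x).fun_neg.exp.const_mul j).congr_deriv ?_
    have h := (hneg (τ x)).ne
    have h1 := hj.ne
    simp only [hKdef]
    field_simp
  refine ⟨fun x => √(2 * H (j * Real.exp (-τ x))), fun x => j * Real.exp (-τ x), fun x => ?_, hv,
    by simp [hτ0], fun x => hneg _, fun x => hslo _ (hneg _).le, fun x => hshi _ (hneg _).le⟩
  have hpos : 0 < √(2 * H (j * Real.exp (-τ x))) := by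
    linarith [hslo _ (hneg (τ x)).le, hneg (τ x)]
  refine ((((hd _).comp x (hv x)).const_mul 2).sqrt (Real.sqrt_pos.1 hpos).ne').congr_deriv ?_
  have := (hGpos (j * Real.exp (-τ x))).ne'
  simp only [Function.comp_apply]
  field_simp

/-- Viète's trigonometric formula for the largest root `m` of `m² (1 - m) = c`. -/
noncomputable def largestRoot (c : ℝ) : ℝ :=
  1 / 3 + 2 / 3 * Real.cos (Real.arccos (1 - 27 / 2 * c) / 3)

theorem continuous_largestRoot : Continuous largestRoot := by
  unfold largestRoot
  fun_prop

theorem largestRoot_le_one (c : ℝ) : largestRoot c ≤ 1 := by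
  unfold largestRoot
  linarith [Real.cos_le_one (Real.arccos (1 - 27 / 2 * c) / 3)]

theorem two_thirds_le_largestRoot (c : ℝ) : 2 / 3 ≤ largestRoot c := by
  have h0 := Real.arccos_nonneg (1 - 27 / 2 * c)
  have h1 := Real.arccos_le_pi (1 - 27 / 2 * c)
  have := Real.cos_le_cos_of_nonneg_of_le_pi (x := Real.arccos (1 - 27 / 2 * c) / 3)
    (y := Real.pi / 3) (by linarith) (by linarith [Real.pi_pos]) (by linarith)
  rw [Real.cos_pi_div_three] at this
  unfold largestRoot
  linarith

theorem largestRoot_spec {c : ℝ} (h0 : 0 ≤ c) (h1 : c ≤ 4 / 27) :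
    largestRoot c ^ 2 * (1 - largestRoot c) = c := by
  have h := Real.cos_three_mul (Real.arccos (1 - 27 / 2 * c) / 3)
  rw [mul_div_cancel₀ _ (by norm_num), Real.cos_arccos (by linarith) (by linarith)] at h
  unfold largestRoot
  linear_combination (2 / 27) * h

theorem two_thirds_lt_largestRoot {c : ℝ} (h0 : 0 ≤ c) (h1 : c < 4 / 27) :
    2 / 3 < largestRoot c := by
  refine (two_thirds_le_largestRoot c).lt_of_ne fun h => ?_
  have := largestRoot_spec h0 h1.le
  rw [← h] at this
  norm_num at this
  linarith

/-- Quantitative strict monotonicity of `m ↦ m² (1 - m)` to the right of its maximum `2/3`. -/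
theorem abs_sub_le_of_sq_mul_one_sub {m n : ℝ} (hm : 2 / 3 < m) (hn : 2 / 3 < n) :
    (n - 2 / 3) * |m - n| ≤ |m ^ 2 * (1 - m) - n ^ 2 * (1 - n)| := by
  have h : m ^ 2 * (1 - m) - n ^ 2 * (1 - n) = -((m ^ 2 + m * n + n ^ 2 - m - n) * (m - n)) := by
    ring
  have h2 : n - 2 / 3 ≤ m ^ 2 + m * n + n ^ 2 - m - n := by nlinarith
  rw [h, abs_neg, abs_mul]
  exact mul_le_mul_of_nonneg_right (h2.trans (le_abs_self _)) (abs_nonneg _)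

open MeasureTheory Set in
theorem integrableOn_sq_of_abs_le_exp {f : ℝ → ℝ} {A b : ℝ} (hf : ContinuousOn f (Ici 0))
    (hb : 0 < b) (h : ∀ x ≥ 0, |f x| ≤ A * Real.exp (-b * x)) :
    IntegrableOn (fun x => f x ^ 2) (Ici 0) := by
  have hg : IntegrableOn (fun x => A ^ 2 * Real.exp (-(2 * b) * x)) (Ici (0 : ℝ)) := by
    rw [integrableOn_Ici_iff_integrableOn_Ioi]
    exact (exp_neg_integrableOn_Ioi 0 (by linarith)).const_mul _
  refine Integrable.mono' hg ((hf.pow 2).aestronglyMeasurable measurableSet_Ici) ?_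
  refine (ae_restrict_iff' measurableSet_Ici).2 (Filter.Eventually.of_forall fun x hx => ?_)
  have h1 := pow_le_pow_left₀ (abs_nonneg _) (h x hx) 2
  rw [mul_pow, ← Real.exp_nat_mul] at h1
  rw [Real.norm_eq_abs, abs_pow]
  refine h1.trans_eq ?_
  congr 2
  push_cast
  ring

/-- Existence of the leading-order boundary-layer profile: for `j_r ≤ 0` with
`j_r² < 4/27` and `μ_j` the unique number in `(√(2/3), 1]` with
`μ_j⁴(1 - μ_j²) = j_r²`, there exist `μ, θ : [0,∞) → ℝ` with `θ` twice continuously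
differentiable and `μ` continuous, satisfying the algebraic-differential system
(i)–(vii). -/
theorem leading_order_boundary_layer (jr μj : ℝ) (hjr : jr ≤ 0)
    (hjr2 : jr ^ 2 < 4 / 27)
    (hμj : μj ∈ Set.Ioc (Real.sqrt (2 / 3)) 1 ∧ μj ^ 4 * (1 - μj ^ 2) = jr ^ 2) :
    ∃ μ θ : ℝ → ℝ,
      ContDiffOn ℝ 2 θ (Set.Ici (0 : ℝ)) ∧ ContinuousOn μ (Set.Ici (0 : ℝ)) ∧
      (∀ η ≥ (0 : ℝ), 2 / 3 < (μ η) ^ 2 ∧ (μ η) ^ 2 ≤ 1) ∧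
      (∀ η ≥ (0 : ℝ),
        (μ η) ^ 4 * (1 - (μ η) ^ 2) =
          (derivWithin θ (Set.Ici (0 : ℝ)) η - jr) ^ 2) ∧
      (∀ η ≥ (0 : ℝ),
        derivWithin (derivWithin θ (Set.Ici (0 : ℝ))) (Set.Ici (0 : ℝ)) η =
          (μ η) ^ 2 * θ η) ∧
      derivWithin θ (Set.Ici (0 : ℝ)) 0 = jr ∧
      (∀ η ≥ (0 : ℝ), 0 ≤ θ η ∧ jr ≤ derivWithin θ (Set.Ici (0 : ℝ)) η ∧
        derivWithin θ (Set.Ici (0 : ℝ)) η ≤ 0) ∧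
      (∀ η ≥ (0 : ℝ),
        θ η ≤ -Real.sqrt (3 / 2) * jr * Real.exp (-Real.sqrt (2 / 3) * η)) ∧
      MeasureTheory.IntegrableOn (fun η => (θ η) ^ 2) (Set.Ici (0 : ℝ)) ∧
      MeasureTheory.IntegrableOn
        (fun η => (derivWithin θ (Set.Ici (0 : ℝ)) η) ^ 2) (Set.Ici (0 : ℝ)) ∧
      MeasureTheory.IntegrableOn (fun η => (μ η - μj) ^ 2) (Set.Ici (0 : ℝ)) := by
  obtain ⟨⟨hμlo, hμ1⟩, hμeq⟩ := hμj
  have hμpos : 0 < μj := (Real.sqrt_nonneg _).trans_lt hμlo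
  have hμsq : 2 / 3 < μj ^ 2 := (Real.sqrt_lt' hμpos).1 hμlo
  set G : ℝ → ℝ := fun v => largestRoot ((v - jr) ^ 2) with hGdef
  have hG : Continuous G := continuous_largestRoot.comp (by fun_prop)
  have hsol : ∃ θ v : ℝ → ℝ, (∀ x, HasDerivAt θ (v x) x) ∧
      (∀ x, HasDerivAt v (G (v x) * θ x) x) ∧ v 0 = jr ∧ (∀ x, v x ≤ 0) ∧
      (∀ x, -v x ≤ θ x) ∧ (∀ x, θ x ≤ √(3 / 2) * -v x) := by
    rcases hjr.lt_or_eq with hlt | rfl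
    · obtain ⟨θ, v, h1, h2, h3, h4, h5, h6⟩ := exists_decaying_solution hG
        (fun _ => two_thirds_le_largestRoot _) (fun _ => largestRoot_le_one _) hlt
      exact ⟨θ, v, h1, h2, h3, fun x => (h4 x).le, h5, h6⟩
    · exact ⟨0, 0, fun x => hasDerivAt_const x 0,
        fun x => (hasDerivAt_const x (0 : ℝ)).congr_deriv (by simp), by simp⟩
  obtain ⟨θ, v, hθ, hv, hv0, hvneg, hvθ, hθv⟩ := hsol
  have hθc : Continuous θ := continuous_iff_continuousAt.2 fun x => (hθ x).continuousAt
  have hvc : Continuous v := continuous_iff_continuousAt.2 fun x => (hv x).continuousAt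
  have hθ0 : ∀ x, 0 ≤ θ x := fun x => by linarith [hvneg x, hvθ x]
  have hGlo : ∀ x, 2 / 3 ≤ G x := fun _ => two_thirds_le_largestRoot _
  have hvmono : Monotone v := monotone_of_hasDerivAt_nonneg hv fun x =>
    mul_nonneg (by linarith [hGlo (v x)]) (hθ0 x)
  have hvj : ∀ x ≥ 0, jr ≤ v x := fun x hx => hv0 ▸ hvmono hx
  have hrange : ∀ x ≥ 0, (v x - jr) ^ 2 < 4 / 27 := fun x hx =>
    lt_of_le_of_lt (by nlinarith [hvj x hx, hvneg x]) hjr2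
  have hdθ : ∀ x ∈ Set.Ici (0 : ℝ), derivWithin θ (Set.Ici 0) x = v x := fun x hx =>
    (hθ x).hasDerivWithinAt.derivWithin (uniqueDiffOn_Ici 0 x hx)
  have hsq : ∀ x, √(G (v x)) ^ 2 = G (v x) := fun x => Real.sq_sqrt (by linarith [hGlo (v x)])
  have hspec : ∀ x ≥ 0, G (v x) ^ 2 * (1 - G (v x)) = (v x - jr) ^ 2 := fun x hx =>
    largestRoot_spec (sq_nonneg _) (hrange x hx).le
  have hGlt : ∀ x ≥ 0, 2 / 3 < G (v x) := fun x hx =>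
    two_thirds_lt_largestRoot (sq_nonneg _) (hrange x hx)
  have hab : √(2 / 3 : ℝ) * √(3 / 2) = 1 := by
    rw [← Real.sqrt_mul (by norm_num)]; norm_num
  have hrate : ∀ x, v x ≤ -√(2 / 3) * θ x := fun x => by
    have := mul_le_mul_of_nonneg_left (hθv x) (Real.sqrt_nonneg (2 / 3))
    rw [← mul_assoc, hab] at this
    linarith
  have hdecay : ∀ x ≥ 0, θ x ≤ -√(3 / 2) * jr * Real.exp (-√(2 / 3) * x) := by
    intro x hx
    have hanti : Antitone fun x => θ x * Real.exp (√(2 / 3) * x) := by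
      refine antitone_of_hasDerivAt_nonpos
        (fun y => (hθ y).fun_mul ((hasDerivAt_id y).const_mul √(2 / 3)).exp) fun y => ?_
      have := mul_le_mul_of_nonneg_right (hrate y) (Real.exp_pos (√(2 / 3) * y)).le
      simp only [id, mul_one]
      simp only [Pi.zero_apply]
      linarith
    have h1 := hanti hx
    simp only [mul_zero, Real.exp_zero, mul_one] at h1
    have h2 := hθv 0
    rw [hv0] at h2
    rw [neg_mul √(2 / 3) x, Real.exp_neg, ← div_eq_mul_inv, le_div_iff₀ (Real.exp_pos _)]
    linarith
  have hμdiff : ∀ x ≥ 0, |√(G (v x)) - μj| ≤ 2 / (μj * (μj ^ 2 - 2 / 3)) * -v x := by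
    intro x hx
    have h1 := abs_sub_le_of_sq_mul_one_sub (hGlt x hx) hμsq
    have h2 : G (v x) ^ 2 * (1 - G (v x)) - (μj ^ 2) ^ 2 * (1 - μj ^ 2) =
        -v x * (2 * jr - v x) := by
      linear_combination hspec x hx - hμeq
    have h3 : |2 * jr - v x| ≤ 2 := by
      have hj1 : -1 < jr := by nlinarith
      rw [abs_le]
      constructor <;> linarith [hvj x hx, hvneg x]
    rw [h2, abs_mul, abs_of_nonneg (by linarith [hvneg x] : 0 ≤ -v x)] at h1
    have h4 : |√(G (v x)) - μj| * μj ≤ |G (v x) - μj ^ 2| := by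
      have : G (v x) - μj ^ 2 = (√(G (v x)) - μj) * (√(G (v x)) + μj) := by
        linear_combination -hsq x
      rw [this, abs_mul]
      refine mul_le_mul_of_nonneg_left ?_ (abs_nonneg _)
      exact (by linarith [Real.sqrt_nonneg (G (v x))] : μj ≤ √(G (v x)) + μj).trans
        (le_abs_self _)
    have h5 := mul_le_mul_of_nonneg_left h3 (by linarith [hvneg x] : 0 ≤ -v x)
    have h6 := mul_le_mul_of_nonneg_left h4 (by linarith : 0 ≤ μj ^ 2 - 2 / 3)
    rw [div_mul_eq_mul_div, le_div_iff₀ (mul_pos hμpos (by linarith))]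
    linarith
  have hC : 0 ≤ 2 / (μj * (μj ^ 2 - 2 / 3)) :=
    div_nonneg zero_le_two (mul_pos hμpos (by linarith)).le
  have hb : (0 : ℝ) < √(2 / 3) := Real.sqrt_pos.2 (by norm_num)
  refine ⟨fun x => √(G (v x)), θ, ?_, (by fun_prop), fun x hx => ?_, fun x hx => ?_,
    fun x hx => ?_, (hdθ 0 Set.self_mem_Ici).trans hv0, fun x hx => ?_, hdecay, ?_, ?_, ?_⟩
  · have hv1 : ContDiff ℝ 1 v := by
      refine contDiff_one_iff_deriv.2 ⟨fun x => (hv x).differentiableAt, ?_⟩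
      rw [show deriv v = fun x => G (v x) * θ x from funext fun x => (hv x).deriv]
      fun_prop
    have hθ2 : ContDiff ℝ (1 + 1) θ := by
      refine contDiff_succ_iff_deriv.2 ⟨fun x => (hθ x).differentiableAt, by simp, ?_⟩
      rwa [show deriv θ = v from funext fun x => (hθ x).deriv]
    exact (hθ2.of_le (by norm_num)).contDiffOn
  · rw [hsq]
    exact ⟨hGlt x hx, largestRoot_le_one _⟩
  · simp only
    rw [hdθ x hx, ← hspec x hx, hsq]
    linear_combination (1 - G (v x)) * (√(G (v x)) ^ 2 + G (v x)) * hsq x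
  · simp only
    rw [derivWithin_congr hdθ (hdθ x hx), hsq]
    exact (hv x).hasDerivWithinAt.derivWithin (uniqueDiffOn_Ici 0 x hx)
  · rw [hdθ x hx]
    exact ⟨hθ0 x, hvj x hx, hvneg x⟩
  · refine integrableOn_sq_of_abs_le_exp (A := -√(3 / 2) * jr) hθc.continuousOn hb fun x hx => ?_
    rw [abs_of_nonneg (hθ0 x)]
    exact hdecay x hx
  · refine integrableOn_sq_of_abs_le_exp (A := -√(3 / 2) * jr)
      (hvc.continuousOn.congr hdθ) hb fun x hx => ?_
    rw [hdθ x hx, abs_of_nonpos (hvneg x)]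
    exact (hvθ x).trans (hdecay x hx)
  · refine integrableOn_sq_of_abs_le_exp (A := 2 / (μj * (μj ^ 2 - 2 / 3)) * (-√(3 / 2) * jr))
      (by fun_prop) hb fun x hx => (hμdiff x hx).trans ?_
    rw [mul_assoc]
    exact mul_le_mul_of_nonneg_left ((hvθ x).trans (hdecay x hx)) hC
end

section
/- Let 0 < μ_j ≤ 1, j_r < 0, let m : [0,∞) → ℝ be continuous with μ_j² ≤ m(η) ≤ 1 for all η ≥ 0, and let θ : [0,∞) → ℝ be twice continuously differentiable with θ''(η) = m(η)·θ(η) for all η ≥ 0, θ'(0) = j_r, θ(η) ≥ 0 for all η, and θ(η) → 0, θ'(η) → 0 as η → ∞. Then for all η ≥ 0: θ(η) ≤ (−j_r/μ_j)·e^{−μ_j·η} and θ'(η) ≥ (j_r/μ_j²)·e^{−μ_j·η}; consequently |θ(η)| + μ_j·|θ'(η)| ≤ (−2j_r/μ_j)·e^{−μ_j·η}. -/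
/-- A function with nonnegative derivative on `[0,∞)` that vanishes at infinity is nonpositive. -/
theorem nonpos_of_hasDerivWithinAt_nonneg_of_tendsto_zero {f f' : ℝ → ℝ}
    (hf : ∀ x ≥ (0 : ℝ), HasDerivWithinAt f (f' x) (Set.Ici 0) x)
    (hf' : ∀ x ≥ (0 : ℝ), 0 ≤ f' x) (hlim : Filter.Tendsto f Filter.atTop (nhds 0))
    {x : ℝ} (hx : 0 ≤ x) : f x ≤ 0 := by
  have hmono : MonotoneOn f (Set.Ici 0) :=
    monotoneOn_of_hasDerivWithinAt_nonneg (convex_Ici 0)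
      (fun y hy => (hf y hy).continuousWithinAt)
      (fun y hy => (hf y (interior_subset hy)).mono interior_subset)
      (fun y hy => hf' y (interior_subset hy))
  refine ge_of_tendsto hlim ?_
  filter_upwards [Filter.eventually_ge_atTop x] with y hy
  exact hmono hx (hx.trans hy) hy

/-- The function `x ↦ e^{cx}` has derivative `c e^{cx}`. -/
theorem hasDerivWithinAt_exp_const_mul (c x : ℝ) (s : Set ℝ) :
    HasDerivWithinAt (fun y => Real.exp (c * y)) (c * Real.exp (c * x)) s x := by
  have h := ((hasDerivAt_id x).const_mul c).exp.hasDerivWithinAt (s := s)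
  simpa [mul_comm] using h


/-- Exponential decay of the boundary-layer potential: if `θ'' = m·θ` on `[0,∞)` with
`μ_j² ≤ m ≤ 1`, `θ'(0) = j_r < 0`, `θ ≥ 0`, and `θ, θ' → 0` at infinity, then
`θ(η) ≤ (-j_r/μ_j)e^{-μ_jη}`, `θ'(η) ≥ (j_r/μ_j²)e^{-μ_jη}` and hence
`|θ(η)| + μ_j|θ'(η)| ≤ (-2j_r/μ_j)e^{-μ_jη}`. -/
theorem potential_exponential_decay (μj jr : ℝ) (hμj0 : 0 < μj) (hμj1 : μj ≤ 1)
    (hjr : jr < 0) (m θ : ℝ → ℝ)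
    (hm : ContinuousOn m (Set.Ici (0 : ℝ)))
    (hmb : ∀ η ≥ (0 : ℝ), μj ^ 2 ≤ m η ∧ m η ≤ 1)
    (hθ : ContDiffOn ℝ 2 θ (Set.Ici (0 : ℝ)))
    (hode : ∀ η ≥ (0 : ℝ),
      derivWithin (derivWithin θ (Set.Ici (0 : ℝ))) (Set.Ici (0 : ℝ)) η = m η * θ η)
    (hθ0 : derivWithin θ (Set.Ici (0 : ℝ)) 0 = jr)
    (hpos : ∀ η ≥ (0 : ℝ), 0 ≤ θ η)
    (hlim : Filter.Tendsto θ Filter.atTop (nhds 0))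
    (hlim' : Filter.Tendsto (derivWithin θ (Set.Ici (0 : ℝ))) Filter.atTop (nhds 0)) :
    ∀ η ≥ (0 : ℝ),
      θ η ≤ (-jr / μj) * Real.exp (-μj * η) ∧
      (jr / μj ^ 2) * Real.exp (-μj * η) ≤ derivWithin θ (Set.Ici (0 : ℝ)) η ∧
      |θ η| + μj * |derivWithin θ (Set.Ici (0 : ℝ)) η| ≤
        (-2 * jr / μj) * Real.exp (-μj * η) := by
  set g := derivWithin θ (Set.Ici (0 : ℝ))
  have hθd : ∀ x ≥ (0 : ℝ), HasDerivWithinAt θ (g x) (Set.Ici 0) x := fun x hx =>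
    (hθ.differentiableOn (by norm_num) x hx).hasDerivWithinAt
  have hgd : ∀ x ≥ (0 : ℝ), HasDerivWithinAt g (m x * θ x) (Set.Ici 0) x := fun x hx => by
    have hC : ContDiffOn ℝ 1 g (Set.Ici 0) :=
      hθ.derivWithin (uniqueDiffOn_Ici 0) (by norm_num)
    rw [← hode x hx]
    exact (hC.differentiableOn (by norm_num) x hx).hasDerivWithinAt
  have hexp : Filter.Tendsto (fun x : ℝ => Real.exp (-μj * x)) Filter.atTop (nhds 0) :=
    Real.tendsto_exp_atBot.comp
      (Filter.tendsto_id.const_mul_atTop_of_neg (neg_lt_zero.mpr hμj0))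
  -- `(θ' + μ_j θ) e^{-μ_j η}` is nondecreasing and vanishes at infinity.
  have hw : ∀ x ≥ (0 : ℝ), g x + μj * θ x ≤ 0 := by
    intro x hx
    have h := nonpos_of_hasDerivWithinAt_nonneg_of_tendsto_zero
      (fun y hy => ((hgd y hy).add ((hθd y hy).const_mul μj)).mul
        (hasDerivWithinAt_exp_const_mul (-μj) y (Set.Ici 0)))
      (fun y hy => by
        have h1 := mul_nonneg (mul_nonneg (sub_nonneg.mpr (hmb y hy).1) (hpos y hy))
          (Real.exp_pos (-μj * y)).le
        simp only [Pi.add_apply]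
        linarith)
      (by
        have h1 := (hlim'.add (hlim.const_mul μj)).mul hexp
        simp only [mul_zero, add_zero] at h1
        exact h1) hx
    exact nonpos_of_mul_nonpos_left h (Real.exp_pos _)
  have hθ_le : ∀ x ≥ (0 : ℝ), θ x ≤ (-jr / μj) * Real.exp (-μj * x) := by
    intro x hx
    have hanti : AntitoneOn (fun y => θ y * Real.exp (μj * y)) (Set.Ici 0) := by
      have hd := fun y (hy : y ∈ Set.Ici (0 : ℝ)) =>
        (hθd y hy).mul (hasDerivWithinAt_exp_const_mul μj y (Set.Ici 0))
      refine antitoneOn_of_hasDerivWithinAt_nonpos (convex_Ici 0)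
        (fun y hy => (hd y hy).continuousWithinAt)
        (fun y hy => (hd y (interior_subset hy)).mono interior_subset) (fun y hy => ?_)
      have h1 := mul_nonpos_of_nonpos_of_nonneg (hw y (interior_subset hy))
        (Real.exp_pos (μj * y)).le
      linarith
    have h0 : θ 0 ≤ -jr / μj := by
      rw [le_div_iff₀ hμj0]
      have := hw 0 le_rfl
      linarith
    have h1 : θ x * Real.exp (μj * x) ≤ θ 0 := by
      simpa using hanti Set.self_mem_Ici hx hx
    rw [neg_mul, Real.exp_neg, ← div_eq_mul_inv, le_div_iff₀ (Real.exp_pos _)]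
    exact h1.trans h0
  have hg_nonpos : ∀ x ≥ (0 : ℝ), g x ≤ 0 := fun x hx =>
    nonpos_of_hasDerivWithinAt_nonneg_of_tendsto_zero hgd
      (fun y hy => mul_nonneg ((sq_nonneg μj).trans (hmb y hy).1) (hpos y hy)) hlim' hx
  -- `(j_r/μ_j²) e^{-μ_j η} - θ'` is nondecreasing and vanishes at infinity.
  have hg_ge : ∀ x ≥ (0 : ℝ), (jr / μj ^ 2) * Real.exp (-μj * x) ≤ g x := by
    intro x hx
    have h := nonpos_of_hasDerivWithinAt_nonneg_of_tendsto_zero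
      (fun y hy => ((hasDerivWithinAt_exp_const_mul (-μj) y (Set.Ici 0)).const_mul
        (jr / μj ^ 2)).sub (hgd y hy))
      (fun y hy => by
        have h1 := mul_le_of_le_one_left (hpos y hy) (hmb y hy).2
        have h2 : jr / μj ^ 2 * (-μj * Real.exp (-μj * y)) =
            -jr / μj * Real.exp (-μj * y) := by
          field_simp
        rw [h2]
        linarith [hθ_le y hy])
      (by
        have h1 := (hexp.const_mul (jr / μj ^ 2)).sub hlim'
        simp only [mul_zero, sub_zero] at h1
        exact h1) hx
    exact sub_nonpos.mp h
  intro x hx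
  refine ⟨hθ_le x hx, hg_ge x hx, ?_⟩
  rw [abs_of_nonneg (hpos x hx), abs_of_nonpos (hg_nonpos x hx)]
  have h1 := mul_le_mul_of_nonneg_left (hg_ge x hx) hμj0.le
  have h2 : μj * (jr / μj ^ 2 * Real.exp (-μj * x)) = jr / μj * Real.exp (-μj * x) := by
    field_simp
  rw [h2] at h1
  have h3 := hθ_le x hx
  rw [neg_div] at h3
  rw [mul_div_assoc]
  linarith
end
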